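/- arXiv:1609.06452 — 9 statements merged into one kernel-verified Lean document; each statement's English description precedes it below -/
import Mathlib

section
/- Let T be a finite group acting transitively on a nonempty finite set Ω and let H0 be the stabiliser of a point of Ω. Let r be a prime. If the number of conjugacy classes of elements of order r in T is strictly greater than the number of conjugacy classes of elements of order r in H0 (with conjugacy taken inside H0), then T contains an element of order r that is a derangement on Ω. -/
/-- The number of conjugacy classes of elements of order `r` in a group `J`. -/
noncomputable def numOrderClasses (J : Type*) [Group J] (r : ℕ) : ℕ :=
  Nat.card {c : ConjClasses J // ∃ x : J, ConjClasses.mk x = c ∧ orderOf x = r}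

/-- If every element of order `r` fixes a point, then the classes of elements of order `r` in a
point stabiliser of a transitive action surject onto those of the whole group. -/
theorem numOrderClasses_le_stabilizer {T Ω : Type*} [Group T] [Finite T] [MulAction T Ω]
    [MulAction.IsPretransitive T Ω] (ω : Ω) (r : ℕ)
    (hfix : ∀ x : T, orderOf x = r → ∃ ω' : Ω, x • ω' = ω') :
    numOrderClasses T r ≤ numOrderClasses (MulAction.stabilizer T ω) r := by
  let H := MulAction.stabilizer T ω
  have : Finite (ConjClasses H) := Finite.of_surjective _ ConjClasses.mk_surjective
  let f : {c : ConjClasses H // ∃ x : H, ConjClasses.mk x = c ∧ orderOf x = r} →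
      {c : ConjClasses T // ∃ x : T, ConjClasses.mk x = c ∧ orderOf x = r} := fun c =>
    ⟨ConjClasses.map H.subtype c.1, by
      obtain ⟨_, x, rfl, hx⟩ := c
      exact ⟨x, rfl, (Subgroup.orderOf_coe x).trans hx⟩⟩
  refine Nat.card_le_card_of_surjective f ?_
  rintro ⟨_, x, rfl, hx⟩
  obtain ⟨ω', hω'⟩ := hfix x hx
  obtain ⟨g, rfl⟩ := MulAction.exists_smul_eq T ω ω'
  have hconj : IsConj (g⁻¹ * x * g) x := isConj_iff.mpr ⟨g, by group⟩
  have hmem : g⁻¹ * x * g ∈ H := by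
    rw [MulAction.mem_stabilizer_iff, mul_smul, mul_smul, hω', inv_smul_smul]
  have hord : orderOf (⟨g⁻¹ * x * g, hmem⟩ : H) = r := by
    rw [← hx, Subgroup.orderOf_mk]
    simpa using (MulAut.conj g⁻¹).orderOf_eq x
  exact ⟨⟨_, _, rfl, hord⟩, Subtype.ext (ConjClasses.mk_eq_mk_iff_isConj.mpr hconj)⟩

/-- Corollary 2.2 (element version): if a transitive group `T` on a nonempty finite set `Ω`
has more conjugacy classes of elements of order `r` than its point stabiliser `H₀`, then
`T` contains a derangement of order `r`. -/
theorem stmt_1 {T Ω : Type*} [Group T] [Finite T] [Finite Ω] [Nonempty Ω] [MulAction T Ω]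
    [MulAction.IsPretransitive T Ω] (ω : Ω) (r : ℕ) (hr : r.Prime)
    (h : numOrderClasses (MulAction.stabilizer T ω) r < numOrderClasses T r) :
    ∃ x : T, orderOf x = r ∧ ∀ ω' : Ω, x • ω' ≠ ω' := by
  by_contra! hfix
  exact (numOrderClasses_le_stabilizer ω r hfix).not_gt h
end

section
/- Let T be a finite group acting transitively on a nonempty finite set Ω and let H0 be the stabiliser of a point of Ω. Let r be a prime. If κ(T,r) > κ(H0,r), i.e. the number of conjugacy classes of subgroups of order r in T is strictly greater than the number of conjugacy classes of subgroups of order r in H0, then T contains an element of order r that is a derangement on Ω. -/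
open Pointwise in
/-- `kappa J r` is the number of conjugacy classes of subgroups of order `r` in `J`,
i.e. the number of orbits of the conjugation action of `J` on its subgroups of
cardinality `r`. -/
noncomputable def kappa (J : Type*) [Group J] (r : ℕ) : ℕ :=
  Nat.card {c : Quotient (MulAction.orbitRel (ConjAct J) (Subgroup J)) //
    ∃ H : Subgroup J, Nat.card H = r ∧
      Quotient.mk (MulAction.orbitRel (ConjAct J) (Subgroup J)) H = c}

open Pointwise in
theorem Subgroup.map_subtype_conjAct_smul {G : Type*} [Group G] (S : Subgroup G)
    (g : ConjAct S) (K : Subgroup S) :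
    (g • K).map S.subtype =
      ConjAct.toConjAct (ConjAct.ofConjAct g : S).1 • K.map S.subtype := by
  ext y
  simp only [Subgroup.mem_map, Subgroup.mem_smul_pointwise_iff_exists]
  constructor
  · rintro ⟨_, ⟨k, hk, rfl⟩, rfl⟩
    exact ⟨k, ⟨k, hk, rfl⟩, by simp [ConjAct.smul_def]⟩
  · rintro ⟨_, ⟨k, hk, rfl⟩, rfl⟩
    exact ⟨g • k, ⟨k, hk, rfl⟩, by simp [ConjAct.smul_def]⟩

open Pointwise in
/-- If every subgroup of order `r` is conjugate to a subgroup of `S`, then `S` has at least as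
many conjugacy classes of subgroups of order `r` as the whole group. -/
theorem kappa_le_of_conj_le {G : Type*} [Group G] [Finite G] (S : Subgroup G) (r : ℕ)
    (h : ∀ L : Subgroup G, Nat.card L = r → ∃ g : ConjAct G, g • L ≤ S) :
    kappa G r ≤ kappa S r := by
  have key : ∀ K₁ K₂ : Subgroup S, MulAction.orbitRel (ConjAct S) (Subgroup S) K₁ K₂ →
      MulAction.orbitRel (ConjAct G) (Subgroup G) (K₁.map S.subtype) (K₂.map S.subtype) := by
    rintro _ K ⟨g, rfl⟩
    exact ⟨_, (Subgroup.map_subtype_conjAct_smul S g K).symm⟩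
  let φ : Quotient (MulAction.orbitRel (ConjAct S) (Subgroup S)) →
      Quotient (MulAction.orbitRel (ConjAct G) (Subgroup G)) :=
    Quotient.map (fun K => K.map S.subtype) key
  have hcard (K : Subgroup S) : Nat.card (K.map S.subtype) = Nat.card K :=
    Subgroup.card_map_of_injective S.subtype_injective
  refine Nat.card_le_card_of_surjective (fun c => ⟨φ c.1, ?_⟩) ?_
  · obtain ⟨_, K, hK, rfl⟩ := c
    exact ⟨K.map S.subtype, (hcard K).trans hK, rfl⟩
  · rintro ⟨_, L, hL, rfl⟩
    obtain ⟨g, hg⟩ := h L hL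
    have hmap : ((g • L).subgroupOf S).map S.subtype = g • L :=
      Subgroup.map_subgroupOf_eq_of_le hg
    refine ⟨⟨Quotient.mk _ ((g • L).subgroupOf S), _, ?_, rfl⟩, Subtype.ext ?_⟩
    · rw [← hcard, hmap, ← hL]
      exact Nat.card_congr (Subgroup.equivSMul g L).symm.toEquiv
    · exact Quotient.sound ⟨g, hmap.symm⟩

/-- Corollary 2.2 (subgroup version): if a transitive group `T` on a nonempty finite set `Ω`
satisfies `κ(T,r) > κ(H₀,r)` for the point stabiliser `H₀`, then `T` contains a
derangement of order `r`. -/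
theorem stmt_2 {T Ω : Type*} [Group T] [Finite T] [Finite Ω] [Nonempty Ω] [MulAction T Ω]
    [MulAction.IsPretransitive T Ω] (ω : Ω) (r : ℕ) (hr : r.Prime)
    (h : kappa (MulAction.stabilizer T ω) r < kappa T r) :
    ∃ x : T, orderOf x = r ∧ ∀ ω' : Ω, x • ω' ≠ ω' := by
  by_contra! hfix
  refine h.not_ge (kappa_le_of_conj_le _ r fun L hL => ?_)
  have : Fact r.Prime := ⟨hr⟩
  have : IsCyclic L := isCyclic_of_prime_card hL
  obtain ⟨x, hx⟩ := IsCyclic.exists_generator (α := L)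
  have hord : orderOf (x : T) = r := by
    rw [Subgroup.orderOf_coe, orderOf_eq_card_of_forall_mem_zpowers hx, hL]
  obtain ⟨ω', hω'⟩ := hfix x hord
  have hle : L ≤ MulAction.stabilizer T ω' := by
    intro y hy
    obtain ⟨n, hn⟩ := hx ⟨y, hy⟩
    have hn : (x : T) ^ n = y := congrArg Subtype.val hn
    rw [← hn]
    exact Subgroup.zpow_mem _ hω' n
  obtain ⟨t, rfl⟩ := MulAction.exists_smul_eq T ω' ω
  refine ⟨ConjAct.toConjAct t, ?_⟩
  rintro _ ⟨y, hy, rfl⟩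
  have hy' : y • ω' = ω' := hle hy
  simp [ConjAct.smul_def, MulAction.mem_stabilizer_iff, mul_smul, hy']
end

section
/- Let F_q be a finite field with q elements, let n ≥ 2, and let r be an odd prime not dividing q. Let i be the smallest positive integer such that r divides q^i − 1, and assume 2 ≤ i ≤ n. Then κ(PSL_n(q), r) = 1 if and only if n < 2i; that is, PSL_n(q) has a unique conjugacy class of subgroups of order r precisely when ⌊n/i⌋ = 1. -/
open Pointwise in
theorem kappa_eq_one_iff {J : Type*} [Group J] {r : ℕ} :
    kappa J r = 1 ↔ (∃ H : Subgroup J, Nat.card H = r) ∧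
      ∀ H H' : Subgroup J, Nat.card H = r → Nat.card H' = r → ∃ g : J, MulAut.conj g • H = H' := by
  have key (H H' : Subgroup J) :
      Quotient.mk (MulAction.orbitRel (ConjAct J) (Subgroup J)) H' = Quotient.mk _ H ↔
        ∃ g : J, MulAut.conj g • H = H' := by
    rw [Quotient.eq, MulAction.orbitRel_apply, MulAction.mem_orbit_iff]
    exact ⟨fun ⟨g, hg⟩ ↦ ⟨ConjAct.ofConjAct g, hg⟩, fun ⟨g, hg⟩ ↦ ⟨ConjAct.toConjAct g, hg⟩⟩
  rw [kappa, Nat.card_eq_one_iff_unique]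
  constructor
  · rintro ⟨hs, ⟨_, H, hH, _⟩⟩
    refine ⟨⟨H, hH⟩, fun H₁ H₂ h₁ h₂ ↦ (key H₁ H₂).1 ?_⟩
    exact congrArg Subtype.val (hs.elim ⟨_, H₂, h₂, rfl⟩ ⟨_, H₁, h₁, rfl⟩)
  · rintro ⟨⟨H, hH⟩, h⟩
    refine ⟨⟨?_⟩, ⟨⟨_, H, hH, rfl⟩⟩⟩
    rintro ⟨_, H₁, h₁, rfl⟩ ⟨_, H₂, h₂, rfl⟩
    exact Subtype.ext ((key H₂ H₁).2 (h H₂ H₁ h₂ h₁))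

theorem Subgroup.eq_of_le_of_card_eq_of_isCyclic {G : Type*} [Group G] {P H H' : Subgroup G}
    [Finite P] [IsCyclic P] {r : ℕ} (hr : 0 < r) (hH : H ≤ P) (hH' : H' ≤ P)
    (h : Nat.card H = r) (h' : Nat.card H' = r) : H = H' := by
  classical
  have := Fintype.ofFinite P
  have key (K : Subgroup G) (hK : K ≤ P) (hc : Nat.card K = r) :
      ((K.subgroupOf P : Subgroup P) : Set P) = {a : P | a ^ r = 1} := by
    have hc' : Nat.card (K.subgroupOf P) = r := by
      rw [← hc]; exact Nat.card_congr (Subgroup.subgroupOfEquivOfLe hK).toEquiv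
    refine Set.eq_of_subset_of_ncard_le (fun x hx ↦ ?_) ?_ (Set.toFinite _)
    · have := pow_card_eq_one' (x := (⟨x, hx⟩ : K.subgroupOf P))
      rwa [hc', Subtype.ext_iff] at this
    · have := IsCyclic.card_pow_eq_one_le (α := P) hr
      rw [← Set.ncard_coe_finset, Finset.coe_filter_univ] at this
      exact this.trans_eq hc'.symm
  have := Subgroup.subgroupOf_inj.1
    (SetLike.coe_injective ((key H hH h).trans (key H' hH' h').symm))
  rwa [inf_eq_left.2 hH, inf_eq_left.2 hH'] at this

open Pointwise in
theorem kappa_eq_one_of_orderOf_eq {J : Type*} [Group J] [Finite J] {r v : ℕ} (hr : r.Prime)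
    (hv : 0 < v) {x : J} (hx : orderOf x = r ^ v) (hJ : (Nat.card J).factorization r ≤ v) :
    kappa J r = 1 := by
  have := Fact.mk hr
  have hJ' : (Nat.card J).factorization r = v := le_antisymm hJ <|
    (hr.pow_dvd_iff_le_factorization Nat.card_pos.ne').1 (hx ▸ orderOf_dvd_natCard x)
  let P : Sylow r J := Sylow.ofCard (Subgroup.zpowers x) (by rw [Nat.card_zpowers, hx, hJ'])
  have hP : (P : Subgroup J) = Subgroup.zpowers x := rfl
  have hcyc : IsCyclic (P : Subgroup J) := hP ▸ inferInstance
  rw [kappa_eq_one_iff]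
  refine ⟨⟨Subgroup.zpowers (x ^ r ^ (v - 1)), ?_⟩, fun H H' h h' ↦ ?_⟩
  · rw [Nat.card_zpowers, orderOf_pow_of_dvd (pow_ne_zero _ hr.ne_zero)
      (hx ▸ pow_dvd_pow r (Nat.sub_le _ _)), hx, Nat.pow_div (Nat.sub_le _ _) hr.pos,
      Nat.sub_sub_self hv, pow_one]
  have key (K : Subgroup J) (hK : Nat.card K = r) : ∃ g : J, MulAut.conj g • K ≤ P := by
    obtain ⟨Q, hQ⟩ := (IsPGroup.of_card (p := r) (n := 1) (by rw [hK, pow_one])).exists_le_sylow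
    obtain ⟨g, hg⟩ := MulAction.exists_smul_eq J Q P
    refine ⟨g, ?_⟩
    rw [← hg, Sylow.coe_subgroup_smul]
    exact Subgroup.pointwise_smul_le_pointwise_smul_iff.2 hQ
  obtain ⟨g, hg⟩ := key H h
  obtain ⟨g', hg'⟩ := key H' h'
  have hc (K : Subgroup J) (g : J) : Nat.card (MulAut.conj g • K : Subgroup J) = Nat.card K :=
    Nat.card_congr (Subgroup.equivSMul _ K).toEquiv.symm
  have := Subgroup.eq_of_le_of_card_eq_of_isCyclic hr.pos hg hg' ((hc _ _).trans h)
    ((hc _ _).trans h')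
  exact ⟨g'⁻¹ * g, by rw [map_mul, mul_smul, this, map_inv, inv_smul_smul]⟩

theorem factorization_prod_pow_sub_pow_le {q n i r : ℕ} (hq : 1 < q) (hr : r.Prime)
    (hrq : ¬ r ∣ q) (hdvd : r ∣ q ^ i - 1) (hmin : ∀ j, 0 < j → r ∣ q ^ j - 1 → i ≤ j)
    (hn : n < 2 * i) :
    (∏ j : Fin n, (q ^ n - q ^ (j : ℕ))).factorization r ≤ (q ^ i - 1).factorization r := by
  have hfac (j : Fin n) : q ^ n - q ^ (j : ℕ) = q ^ (j : ℕ) * (q ^ (n - j) - 1) := by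
    rw [Nat.mul_sub, mul_one, ← pow_add, Nat.add_sub_cancel' j.2.le]
  have hpos (m : ℕ) (hm : 0 < m) : q ^ m - 1 ≠ 0 :=
    (Nat.sub_pos_of_lt (Nat.one_lt_pow hm.ne' hq)).ne'
  have hcop : r.Coprime q := (Nat.Prime.coprime_iff_not_dvd hr).2 hrq
  have heq (m : ℕ) (hm : 0 < m) (hmn : m ≤ n) (h : r ∣ q ^ m - 1) : m = i := by
    have h1 := hmin m hm h
    by_contra hne
    have h2 : q ^ m - 1 = q ^ i * (q ^ (m - i) - 1) + (q ^ i - 1) := by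
      have : q ^ m = q ^ i * q ^ (m - i) := by rw [← pow_add, Nat.add_sub_cancel' h1]
      have h3 : 0 < q ^ i := by positivity
      have h4 : q ^ i ≤ q ^ i * q ^ (m - i) := Nat.le_mul_of_pos_right _ (by positivity)
      rw [this, Nat.mul_sub, mul_one]; omega
    rw [h2, Nat.dvd_add_left hdvd] at h
    have := hmin (m - i) (by omega) ((hcop.pow_right i).dvd_of_dvd_mul_left h)
    omega
  have hterm (j : Fin n) : (q ^ n - q ^ (j : ℕ)).factorization r =
      if n - j = i then (q ^ i - 1).factorization r else 0 := by
    rw [hfac, Nat.factorization_mul (by positivity) (hpos _ (by omega)), Finsupp.add_apply,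
      Nat.factorization_eq_zero_of_not_dvd (fun h ↦ hrq (hr.dvd_of_dvd_pow h)), zero_add]
    split_ifs with h
    · rw [h]
    · exact Nat.factorization_eq_zero_of_not_dvd fun h' ↦ h (heq _ (by omega) (by omega) h')
  rw [Nat.factorization_prod (fun j _ ↦ by
      rw [hfac]; exact mul_ne_zero (by positivity) (hpos _ (by omega))),
    Finsupp.finsetSum_apply, Finset.sum_congr rfl fun j _ ↦ hterm j, ← Finset.sum_filter,
    Finset.sum_const, smul_eq_mul]
  refine mul_le_of_le_one_left (Nat.zero_le _) (Finset.card_le_one.2 fun a ha b hb ↦ ?_)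
  simp only [Finset.mem_filter] at ha hb
  ext; omega

theorem FiniteField.eq_one_of_pow_eq_one {F : Type*} [Field F] [Fintype F] {m : ℕ} (hm0 : m ≠ 0)
    (hm : m.Coprime (Fintype.card F - 1)) {a : F} (ha : a ^ m = 1) : a = 1 := by
  have ha0 : a ≠ 0 := by
    rintro rfl
    rw [zero_pow hm0] at ha
    exact zero_ne_one ha
  have := pow_gcd_eq_one.2 ⟨ha, pow_card_sub_one_eq_one a ha0⟩
  rwa [hm.gcd_eq_one, pow_one] at this

namespace Matrix.SpecialLinearGroup

variable {F : Type*} [Field F] {ι : Type*} [Fintype ι] [DecidableEq ι]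

theorem orderOf_coe (A : SpecialLinearGroup ι F) : orderOf (A : Matrix ι ι F) = orderOf A :=
  orderOf_injective coeMonoidHom coeMonoidHom_injective A

theorem natCard_dvd_natCard_GL : Nat.card (SpecialLinearGroup ι F) ∣ Nat.card (GL ι F) :=
  Subgroup.card_dvd_of_injective toGL toGL_injective

variable [Fintype F]

theorem exists_coe_eq_of_pow_eq_one {m : ℕ} (hm0 : m ≠ 0) (hm : m.Coprime (Fintype.card F - 1))
    {A : Matrix ι ι F} (hA : A ^ m = 1) : ∃ B : SpecialLinearGroup ι F, (B : Matrix ι ι F) = A :=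
  ⟨⟨A, FiniteField.eq_one_of_pow_eq_one hm0 hm (by rw [← det_pow, hA, det_one])⟩, rfl⟩

theorem eq_one_of_mem_center_of_pow_eq_one {m : ℕ} (hm0 : m ≠ 0)
    (hm : m.Coprime (Fintype.card F - 1))
    {z : SpecialLinearGroup ι F} (hz : z ∈ Subgroup.center (SpecialLinearGroup ι F))
    (h : z ^ m = 1) : z = 1 := by
  obtain ⟨a, -, ha⟩ := mem_center_iff.1 hz
  rcases isEmpty_or_nonempty ι with _ | ⟨⟨j⟩⟩
  · exact Subsingleton.elim _ _
  have h1 : scalar ι (a ^ m) = scalar ι 1 := by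
    rw [map_pow, ha, ← coe_pow, h, coe_one, map_one]
  have : Nonempty ι := ⟨j⟩
  rw [scalar_inj] at h1
  ext1
  rw [← ha, FiniteField.eq_one_of_pow_eq_one hm0 hm h1, map_one, coe_one]

theorem orderOf_mk_of_pow_eq_one {m : ℕ} (hm0 : m ≠ 0) (hm : m.Coprime (Fintype.card F - 1))
    {A : SpecialLinearGroup ι F} (hA : A ^ m = 1) :
    orderOf (A : ProjectiveSpecialLinearGroup ι F) = orderOf A := by
  refine Nat.dvd_antisymm (orderOf_map_dvd (QuotientGroup.mk' _) A) ?_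
  rw [orderOf_dvd_iff_pow_eq_one]
  refine eq_one_of_mem_center_of_pow_eq_one hm0 hm ?_
    (by rw [← pow_mul, mul_comm, pow_mul, hA, one_pow])
  rw [← QuotientGroup.eq_one_iff, QuotientGroup.mk_pow, pow_orderOf_eq_one]

end Matrix.SpecialLinearGroup

/-- Multiplication on the algebra `E`, extended by the identity on the module `W`. -/
def lmulProdId (F E W : Type*) [CommRing F] [CommRing E] [Algebra F E] [AddCommGroup W]
    [Module F W] : E →* Module.End F (E × W) where
  toFun x := (Algebra.lmul F E x).prodMap 1
  map_one' := by ext <;> simp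
  map_mul' x y := by ext <;> simp [mul_assoc]

open Matrix Module in
theorem Matrix.SpecialLinearGroup.exists_orderOf_eq {F : Type*} [Field F] [Fintype F]
    {E : Type*} [CommRing E] [Algebra F E] [Module.Finite F E] {n : ℕ} (hE : finrank F E ≤ n)
    {m : ℕ} (hm0 : m ≠ 0) (hm : m.Coprime (Fintype.card F - 1)) {x : E} (hx : x ^ m = 1) :
    ∃ A : SpecialLinearGroup (Fin n) F, orderOf A = orderOf x ∧
      (∀ s, ((A : Matrix (Fin n) (Fin n) F) ^ s - 1).rank ≤ finrank F E) ∧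
      ∀ s, IsUnit (x ^ s - 1) →
        finrank F E ≤ ((A : Matrix (Fin n) (Fin n) F) ^ s - 1).rank := by
  let W := Fin (n - finrank F E) → F
  let b : Basis (Fin n) F (E × W) := finBasisOfFinrankEq F (E × W) (by simp [W, hE])
  let φ : E →* Matrix (Fin n) (Fin n) F :=
    ((LinearMap.toMatrixAlgEquiv b : _ →* Matrix (Fin n) (Fin n) F)).comp (lmulProdId F E W)
  have hφ : Function.Injective φ := by
    refine (LinearMap.toMatrixAlgEquiv b).injective.comp fun y z h ↦ ?_
    simpa [lmulProdId] using congrArg Prod.fst (LinearMap.congr_fun h (1, 0))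
  have hrank (y : E) : (φ y - 1).rank = finrank F (LinearMap.range (Algebra.lmul F E (y - 1))) := by
    have h1 : φ y - 1 = LinearMap.toMatrixAlgEquiv b (lmulProdId F E W y - 1) := by
      rw [map_sub, map_one]; rfl
    have h2 : lmulProdId F E W y - 1 =
        LinearMap.inl F E W ∘ₗ Algebra.lmul F E (y - 1) ∘ₗ LinearMap.fst F E W := by
      ext <;> simp [lmulProdId]
    rw [h1, Matrix.rank_eq_finrank_range_toLin _ b b,
      show toLin b b (LinearMap.toMatrixAlgEquiv b _) = _ from toLin_toMatrix b b _, h2,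
      LinearMap.range_comp, LinearMap.range_comp_of_range_eq_top _
        (LinearMap.range_eq_top.2 LinearMap.fst_surjective)]
    exact (Submodule.equivMapOfInjective _ LinearMap.inl_injective _).finrank_eq.symm
  obtain ⟨A, hA⟩ := exists_coe_eq_of_pow_eq_one hm0 hm (A := φ x) (by rw [← map_pow, hx, map_one])
  refine ⟨A, ?_, fun s ↦ ?_, fun s hs ↦ ?_⟩
  · rw [← orderOf_coe, hA, orderOf_injective φ hφ]
  · rw [hA, ← map_pow, hrank]
    exact Submodule.finrank_le _
  · rw [hA, ← map_pow, hrank, LinearMap.range_eq_top.2, finrank_top]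
    intro y
    obtain ⟨u, hu⟩ := hs
    exact ⟨↑u⁻¹ * y, by simp [← hu]⟩

open Matrix Pointwise in
theorem Matrix.ProjectiveSpecialLinearGroup.rank_eq_of_conj_zpowers_eq {F : Type*} [Field F]
    [Fintype F] {ι : Type*} [Fintype ι] [DecidableEq ι] {m : ℕ} (hm0 : m ≠ 0)
    (hm : m.Coprime (Fintype.card F - 1)) {A B : SpecialLinearGroup ι F} (hA : A ^ m = 1)
    (hB : B ^ m = 1) {g : ProjectiveSpecialLinearGroup ι F}
    (h : MulAut.conj g • Subgroup.zpowers (A : ProjectiveSpecialLinearGroup ι F) =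
      Subgroup.zpowers (B : ProjectiveSpecialLinearGroup ι F)) :
    ∃ s : ℕ, ((A : Matrix ι ι F) - 1).rank = ((B : Matrix ι ι F) ^ s - 1).rank := by
  obtain ⟨C, rfl⟩ := QuotientGroup.mk_surjective g
  have h1 : MulAut.conj (C : ProjectiveSpecialLinearGroup ι F) •
      (A : ProjectiveSpecialLinearGroup ι F) ∈
        Subgroup.zpowers (B : ProjectiveSpecialLinearGroup ι F) :=
    h ▸ Subgroup.smul_mem_pointwise_smul _ _ _ (Subgroup.mem_zpowers _)
  rw [← mem_powers_iff_mem_zpowers] at h1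
  obtain ⟨s, hs⟩ := h1
  have hs' : ((B ^ s : SpecialLinearGroup ι F) : ProjectiveSpecialLinearGroup ι F) =
      ((C * A * C⁻¹ : SpecialLinearGroup ι F) : ProjectiveSpecialLinearGroup ι F) := hs
  rw [QuotientGroup.eq] at hs'
  set z := (B ^ s)⁻¹ * (C * A * C⁻¹) with hz
  have hz' : C * A * C⁻¹ = B ^ s * z := by rw [hz, mul_inv_cancel_left]
  have hz1 : z = 1 := by
    refine SpecialLinearGroup.eq_one_of_mem_center_of_pow_eq_one hm0 hm hs' ?_
    have hcomm : Commute (B ^ s) z := Subgroup.mem_center_iff.1 hs' _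
    have := congrArg (· ^ m) hz'
    simpa [conj_pow, hA, hcomm.mul_pow, ← pow_mul, mul_comm s, pow_mul B, hB] using this.symm
  rw [hz1, mul_one] at hz'
  refine ⟨s, ?_⟩
  have hC : IsUnit (C : Matrix ι ι F).det := by simp
  have hC' : IsUnit ((C⁻¹ : SpecialLinearGroup ι F) : Matrix ι ι F).det := by
    rw [SpecialLinearGroup.det_coe]; exact isUnit_one
  have : (B : Matrix ι ι F) ^ s - 1 =
      C * (A - 1 : Matrix ι ι F) * (C⁻¹ : SpecialLinearGroup ι F) := by
    rw [← SpecialLinearGroup.coe_pow, ← hz', mul_sub, sub_mul, mul_one,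
      ← SpecialLinearGroup.coe_mul, ← SpecialLinearGroup.coe_mul, ← SpecialLinearGroup.coe_mul,
      mul_inv_cancel, SpecialLinearGroup.coe_one]
  rw [this, rank_mul_eq_left_of_isUnit_det _ _ hC', rank_mul_eq_right_of_isUnit_det _ _ hC]

theorem FiniteField.exists_orderOf_eq_of_dvd {K : Type*} [Field K] [Finite K] {d : ℕ}
    (hd : d ∣ Nat.card K - 1) : ∃ x : K, orderOf x = d := by
  rw [← Nat.card_units] at hd
  obtain ⟨g, hg⟩ := IsCyclic.exists_ofOrder_eq_natCard (α := Kˣ)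
  obtain ⟨e, he⟩ := hd
  have hc : 0 < Nat.card Kˣ := Nat.card_pos
  have he0 : e ≠ 0 := by rintro rfl; omega
  refine ⟨((g ^ e : Kˣ) : K), ?_⟩
  rw [orderOf_units, orderOf_pow_of_dvd he0 (hg ▸ ⟨d, by rw [he, mul_comm]⟩), hg, he,
    Nat.mul_div_cancel _ (Nat.pos_of_ne_zero he0)]

/-- Lemma 2.5(i), linear case: for an odd prime `r` not dividing `q`, with `i` the
smallest positive integer such that `r ∣ q^i - 1` and `2 ≤ i ≤ n`, the group
`PSL_n(q)` has a unique conjugacy class of subgroups of order `r` iff `n < 2i`. -/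
theorem stmt_4 {q n i : ℕ} (r : ℕ) (F : Type*) [Field F] [Fintype F]
    (hq : Fintype.card F = q) (hn : 2 ≤ n) (hr : r.Prime) (hodd : Odd r)
    (hrq : ¬ r ∣ q)
    (hi : 0 < i ∧ r ∣ q ^ i - 1 ∧ ∀ j, 0 < j → r ∣ q ^ j - 1 → i ≤ j)
    (hi2 : 2 ≤ i) (hin : i ≤ n) :
    kappa (Matrix.ProjectiveSpecialLinearGroup (Fin n) F) r = 1 ↔ n < 2 * i := by
  classical
  subst hq
  obtain ⟨hi0, hdvd, hmin⟩ := hi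
  have hq1 : 1 < Fintype.card F := Fintype.one_lt_card
  have hcop1 : r.Coprime (Fintype.card F - 1) := by
    rw [hr.coprime_iff_not_dvd]
    intro h
    have := hmin 1 one_pos (by rwa [pow_one])
    omega
  have := NeZero.mk hi0.ne'
  obtain ⟨p, hp⟩ := CharP.exists F
  have := Fact.mk (CharP.char_is_prime F p)
  let K := FiniteField.Extension F p i
  have hK : Module.finrank F K = i := FiniteField.finrank_extension F p i
  have hKc : Nat.card K = Fintype.card F ^ i := by
    rw [FiniteField.natCard_extension, Nat.card_eq_fintype_card]
  have hN : Fintype.card F ^ i - 1 ≠ 0 := (Nat.sub_pos_of_lt (Nat.one_lt_pow hi0.ne' hq1)).ne'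
  constructor
  · intro hk
    by_contra! hn2
    obtain ⟨ζ, hζ⟩ := FiniteField.exists_orderOf_eq_of_dvd (K := K) (hKc ▸ hdvd)
    have hζr : ζ ^ r = 1 := hζ ▸ pow_orderOf_eq_one ζ
    have hζ1 : ζ ≠ 1 := by
      rintro rfl
      exact hr.one_lt.ne (orderOf_one.symm.trans hζ)
    have hKK : Module.finrank F (K × K) = 2 * i := by rw [Module.finrank_prod, hK, two_mul]
    obtain ⟨A, hA, -, hA'⟩ := Matrix.SpecialLinearGroup.exists_orderOf_eq (n := n) (F := F)
      (hKK.trans_le hn2) hr.ne_zero hcop1 (x := (ζ, ζ)) (by ext <;> exact hζr)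
    obtain ⟨B, hB, hB', -⟩ := Matrix.SpecialLinearGroup.exists_orderOf_eq (n := n) (F := F)
      (hK.trans_le hin) hr.ne_zero hcop1 hζr
    rw [Prod.orderOf_mk, hζ, Nat.lcm_self] at hA
    rw [hζ] at hB
    have hAr : A ^ r = 1 := hA ▸ pow_orderOf_eq_one A
    have hBr : B ^ r = 1 := hB ▸ pow_orderOf_eq_one B
    obtain ⟨g, hg⟩ := (kappa_eq_one_iff.1 hk).2 _ _
      ((Nat.card_zpowers _).trans
        ((Matrix.SpecialLinearGroup.orderOf_mk_of_pow_eq_one hr.ne_zero hcop1 hAr).trans hA))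
      ((Nat.card_zpowers _).trans
        ((Matrix.SpecialLinearGroup.orderOf_mk_of_pow_eq_one hr.ne_zero hcop1 hBr).trans hB))
    obtain ⟨s, hs⟩ := Matrix.ProjectiveSpecialLinearGroup.rank_eq_of_conj_zpowers_eq
      hr.ne_zero hcop1 hAr hBr hg
    have h1 := hA' 1 (by
      rw [pow_one, Prod.isUnit_iff]
      exact ⟨(sub_ne_zero.2 hζ1).isUnit, (sub_ne_zero.2 hζ1).isUnit⟩)
    rw [pow_one, hs, hKK] at h1
    have h2 := hB' s
    rw [hK] at h2
    omega
  · intro hn2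
    set v := (Fintype.card F ^ i - 1).factorization r with hv
    have hv0 : 0 < v := hr.factorization_pos_of_dvd hN hdvd
    obtain ⟨ζ, hζ⟩ := FiniteField.exists_orderOf_eq_of_dvd (K := K) (d := r ^ v)
      (hKc ▸ Nat.ordProj_dvd _ _)
    have hrv : r ^ v ≠ 0 := pow_ne_zero _ hr.ne_zero
    have hcopv := hcop1.pow_left v
    obtain ⟨A, hA, -⟩ := Matrix.SpecialLinearGroup.exists_orderOf_eq (n := n) (F := F)
      (hK.trans_le hin) hrv hcopv (x := ζ) (hζ ▸ pow_orderOf_eq_one ζ)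
    rw [hζ] at hA
    refine kappa_eq_one_of_orderOf_eq hr hv0
      ((Matrix.SpecialLinearGroup.orderOf_mk_of_pow_eq_one hrv hcopv
        (hA ▸ pow_orderOf_eq_one A)).trans hA) ?_
    refine le_trans ?_ (factorization_prod_pow_sub_pow_le hq1 hr hrq hdvd hmin hn2)
    rw [← Matrix.card_GL_field]
    exact (Nat.factorization_le_iff_dvd Nat.card_pos.ne' Nat.card_pos.ne').2
      ((Subgroup.card_quotient_dvd_card _).trans
        Matrix.SpecialLinearGroup.natCard_dvd_natCard_GL) r
end

section
/- Let F_q be a finite field with q elements, let n ≥ 2, and let r be an odd prime not dividing q. Let i be the smallest positive integer such that r divides q^i − 1, and assume i ≥ 2 and ⌊n/i⌋ = 2. Then i divides r − 1 and κ(PSL_n(q), r) ≤ (r−1)/i + 1. -/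
open Polynomial in
theorem exists_irreducible_dvd_aeval_apply_eq_zero {F V : Type*} [Field F] [AddCommGroup V]
    [Module F V] (f : Module.End F V) {Q : F[X]} (hQ : Q ≠ 0) {w : V} (hw : w ≠ 0)
    (h : aeval f Q w = 0) :
    ∃ p : F[X], Irreducible p ∧ p ∣ Q ∧ ∃ v ≠ 0, aeval f p v = 0 := by
  induction Q using WfDvdMonoid.induction_on_irreducible with
  | zero => exact absurd rfl hQ
  | unit u hu =>
    obtain ⟨u', hu'⟩ := hu.exists_left_inv
    refine absurd ?_ hw
    have := congrArg (fun P => aeval f P w) hu'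
    simpa [h] using this.symm
  | mul a p ha hp ih =>
    rw [mul_comm] at h
    by_cases h0 : aeval f a w = 0
    · obtain ⟨p', h1, h2, h3⟩ := ih ha h0
      exact ⟨p', h1, h2.mul_left _, h3⟩
    · refine ⟨p, hp, dvd_mul_right _ _, _, h0, ?_⟩
      rw [mul_comm] at h
      simpa using h

open Polynomial in
/-- A nontrivial linear map of prime order `r` splits off a copy of the cyclotomic extension. -/
theorem exists_equiv_prod_of_pow_eq_one {F K V : Type*} [Field F] [Field K] [Algebra F K]
    [AddCommGroup V] [Module F V] [FiniteDimensional F V] {r : ℕ} (hr : r.Prime)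
    (hrF : (r : F) ≠ 0) [IsCyclotomicExtension {r} F K] (f : Module.End F V) (hf : f ^ r = 1)
    (hf1 : f ≠ 1) :
    ∃ μ : K, IsPrimitiveRoot μ r ∧ ∃ (U : Submodule F V) (T : Module.End F U), T ^ r = 1 ∧
      ∃ e : V ≃ₗ[F] K × U, ∀ v, e (f v) = (μ * (e v).1, T (e v).2) := by
  have : NeZero r := ⟨hr.ne_zero⟩
  have : Fact r.Prime := ⟨hr⟩
  have : NeZero (r : K) := ⟨by
    rw [← map_natCast (algebraMap F K)]; exact (_root_.map_ne_zero _).mpr hrF⟩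
  obtain ⟨w, hw⟩ : ∃ w, f w - w ≠ 0 := by
    by_contra! h
    exact hf1 (LinearMap.ext fun w => sub_eq_zero.mp (h w))
  have hann : aeval f (cyclotomic r F) (f w - w) = 0 := by
    have h1 : aeval f (cyclotomic r F * (X - 1)) w = 0 := by
      rw [cyclotomic_prime_mul_X_sub_one]; simp [hf]
    simpa using h1
  obtain ⟨p, hp, hpd, v, hv, hpv⟩ :=
    exists_irreducible_dvd_aeval_apply_eq_zero f (cyclotomic_ne_zero r F) hw hann
  obtain ⟨μ, hμ⟩ : ∃ μ : K, aeval μ p = 0 := by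
    have hs : (p.map (algebraMap F K)).Splits :=
      (IsCyclotomicExtension.splits_cyclotomic F K (Set.mem_singleton r)).of_dvd
        (Polynomial.map_ne_zero (cyclotomic_ne_zero r F)) (Polynomial.map_dvd _ hpd)
    obtain ⟨μ, h⟩ := hs.exists_eval_eq_zero (by
      rw [degree_map]; exact hp.degree_pos.ne')
    exact ⟨μ, by rwa [eval_map_algebraMap] at h⟩
  have hprim : IsPrimitiveRoot μ r := by
    rw [← isRoot_cyclotomic_iff, ← map_cyclotomic r (algebraMap F K), IsRoot.def,
      eval_map_algebraMap]
    obtain ⟨c, hc⟩ := hpd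
    rw [hc, map_mul, hμ, zero_mul]
  have hmin : ∀ h : F[X], aeval μ h = 0 → p ∣ h := fun h hh => by
    by_contra hn
    obtain ⟨a, b, hab⟩ := (hp.coprime_iff_not_dvd).mpr hn
    have := congrArg (aeval μ) hab
    simp [hμ, hh] at this
  let ev : F[X] →ₗ[F] K := (aeval μ).toLinearMap
  have hev : Function.Surjective ev := fun x => by
    have hx : x ∈ Algebra.adjoin F {μ} := by
      rw [IsCyclotomicExtension.adjoin_primitive_root_eq_top hprim]; trivial
    rw [Algebra.adjoin_singleton_eq_range_aeval] at hx
    exact hx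
  obtain ⟨s, hs⟩ := ev.exists_rightInverse_of_surjective (LinearMap.range_eq_top.mpr hev)
  have hs' : ∀ x, aeval μ (s x) = x := fun x => LinearMap.congr_fun hs x
  let g : F[X] →ₗ[F] V := (LinearMap.applyₗ v).comp (aeval f).toLinearMap
  have hg : ∀ h, g h = aeval f h v := fun h => rfl
  have hgev : ∀ h h' : F[X], aeval μ h = aeval μ h' → g h = g h' := fun h h' hh => by
    obtain ⟨c, hc⟩ := hmin (h - h') (by simp [hh])
    rw [← sub_eq_zero, ← map_sub, hc, hg, mul_comm, map_mul, Module.End.mul_apply, hpv, map_zero]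
  let φ : K →ₗ[F] V := g.comp s
  have hφ : ∀ x, φ (μ * x) = f (φ x) := fun x => by
    change g (s (μ * x)) = f (g (s x))
    rw [hgev _ (X * s x) (by simp [hs']), hg, hg]
    simp
  have hφinj : LinearMap.ker φ = ⊥ := by
    rw [LinearMap.ker_eq_bot']
    intro x hx
    by_contra hx0
    apply hv
    have : ¬ p ∣ s x := fun ⟨c, hc⟩ => hx0 (by rw [← hs' x, hc, map_mul, hμ, zero_mul])
    obtain ⟨a, b, hab⟩ := (hp.coprime_iff_not_dvd).mpr this
    have hx' : aeval f (s x) v = 0 := hx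
    have := congrArg (fun P => aeval f P v) hab
    simpa [hpv, hx'] using this.symm
  have hss : f.IsSemisimple := by
    refine Module.End.isSemisimple_of_squarefree_aeval_eq_zero (p := X ^ r - 1) ?_ (by simp [hf])
    exact (X_pow_sub_one_separable_iff.mpr hrF).squarefree
  obtain ⟨U, hU, hc⟩ := Module.End.isSemisimple_iff.mp hss (LinearMap.range φ) (by
    rw [Module.End.mem_invtSubmodule]
    rintro _ ⟨x, rfl⟩
    exact ⟨μ * x, hφ x⟩)
  have hU' : ∀ x ∈ U, f x ∈ U := hU
  let e : (K × U) ≃ₗ[F] V := LinearEquiv.ofBijective (φ.coprod U.subtype) (by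
    constructor
    · rw [← LinearMap.ker_eq_bot, LinearMap.ker_coprod_of_disjoint_range, hφinj, U.ker_subtype,
        Submodule.prod_bot]
      rw [U.range_subtype]; exact hc.disjoint
    · rw [← LinearMap.range_eq_top, LinearMap.range_coprod, U.range_subtype]
      exact hc.sup_eq_top)
  have he : ∀ x, e x = φ x.1 + x.2 := fun x => rfl
  refine ⟨μ, hprim, U, f.restrict hU', ?_, e.symm, fun v => ?_⟩
  · rw [Module.End.pow_restrict]
    ext x
    simp [hf]
  · obtain ⟨x, rfl⟩ := e.surjective v
    rw [LinearEquiv.symm_apply_eq, e.symm_apply_apply, he, he, map_add, hφ]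
    rfl

/-- The similarity types of a linear map of order `r` for which each nontrivial irreducible
constituent has dimension `[K : F]` and there are at most two of them, normalised so that one
constituent is multiplication by `ζ`. The second one is recorded by the class of its exponent modulo
the Frobenius orbits. -/
def HasNormalForm {F K V : Type*} [Field F] [Field K] [Algebra F K] [AddCommGroup V] [Module F V]
    {r : ℕ} (ζ : K) (u : (ZMod r)ˣ) (f : Module.End F V) :
    Option ((ZMod r)ˣ ⧸ Subgroup.zpowers u) → Prop
  | none => ∃ e : V ≃ₗ[F] K × (Fin (Module.finrank F V - Module.finrank F K) → F),
      ∀ v, e (f v) = (ζ * (e v).1, (e v).2)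
  | some c => ∃ e : V ≃ₗ[F]
        K × (K × (Fin (Module.finrank F V - Module.finrank F K - Module.finrank F K) → F)),
      ∀ v, e (f v) = (ζ * (e v).1, (ζ ^ (c.out : ZMod r).val * (e v).2.1, (e v).2.2))

theorem exists_equiv_mul_pow {F K : Type*} [Field F] [Fintype F] [Field K] [Algebra F K]
    [Algebra.IsAlgebraic F K] {r : ℕ} [NeZero r] {ζ : K} (hζ : ζ ^ r = 1) {u : (ZMod r)ˣ}
    (hu : (u : ZMod r) = Fintype.card F) (w : (ZMod r)ˣ) {j : ℕ} (hj : (w : ZMod r) = j) :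
    ∃ σ : K ≃ₗ[F] K, ∀ x, σ (ζ ^ j * x) =
      ζ ^ ((w : (ZMod r)ˣ ⧸ Subgroup.zpowers u).out : ZMod r).val * σ x := by
  set o := (w : (ZMod r)ˣ ⧸ Subgroup.zpowers u).out
  have h1 : (w : (ZMod r)ˣ ⧸ Subgroup.zpowers u) = o := (QuotientGroup.out_eq' _).symm
  rw [QuotientGroup.eq, ← mem_powers_iff_mem_zpowers] at h1
  obtain ⟨m, hm⟩ := h1
  have h2 : o = w * u ^ m := by simp only [hm, mul_inv_cancel_left]
  refine ⟨((FiniteField.frobeniusAlgEquivOfAlgebraic F K) ^ m).toLinearEquiv, fun x => ?_⟩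
  have h3 : ζ ^ (o : ZMod r).val = ζ ^ (j * Fintype.card F ^ m) := by
    apply pow_eq_pow_of_modEq _ hζ
    rw [← ZMod.natCast_eq_natCast_iff]
    simp [h2, hj, hu]
  have h4 : ∀ y : K, ((FiniteField.frobeniusAlgEquivOfAlgebraic F K) ^ m) y
      = y ^ Fintype.card F ^ m := fun y => by
    have := FiniteField.coe_frobeniusAlgEquivOfAlgebraic_iterate F K m
    rw [AlgEquiv.coe_pow, this]
  simp only [AlgEquiv.toLinearEquiv_apply]
  rw [h3, map_mul, h4 (ζ ^ j), pow_mul]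

theorem exists_pow_hasNormalForm {F K V : Type*} [Field F] [Fintype F] [Field K] [Algebra F K]
    [FiniteDimensional F K] [AddCommGroup V] [Module F V] [FiniteDimensional F V] {r : ℕ}
    (hr : r.Prime) (hrF : (r : F) ≠ 0) [IsCyclotomicExtension {r} F K] {ζ : K}
    (hζ : IsPrimitiveRoot ζ r) {u : (ZMod r)ˣ} (hu : (u : ZMod r) = Fintype.card F)
    (hdim : Module.finrank F V < 3 * Module.finrank F K)
    (f : Module.End F V) (hf : f ^ r = 1) (hf1 : f ≠ 1) :
    ∃ k : ℕ, k.Coprime r ∧ ∃ s, HasNormalForm ζ u (f ^ k) s := by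
  have : NeZero r := ⟨hr.ne_zero⟩
  obtain ⟨μ, hμ, U, T, hT, e, he⟩ := exists_equiv_prod_of_pow_eq_one (K := K) hr hrF f hf hf1
  obtain ⟨k, -, hk, rfl⟩ := hμ.isPrimitiveRoot_iff.mp hζ
  have hek : ∀ m v, e ((f ^ m) v) = (μ ^ m * (e v).1, (T ^ m) (e v).2) := fun m v => by
    induction m with
    | zero => simp
    | succ m ih => rw [pow_succ', Module.End.mul_apply, he, ih, pow_succ', pow_succ', mul_assoc]; rfl
  have hU : Module.finrank F V = Module.finrank F K + Module.finrank F U := by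
    rw [e.finrank_eq, Module.finrank_prod]
  refine ⟨k, hk, ?_⟩
  by_cases hTk : T ^ k = 1
  · let d : U ≃ₗ[F] (Fin (Module.finrank F V - Module.finrank F K) → F) :=
      LinearEquiv.ofFinrankEq _ _ (by simp [hU])
    refine ⟨none, e.trans ((LinearEquiv.refl F K).prodCongr d), fun v => ?_⟩
    simp [hek, hTk]
  · obtain ⟨ν, hν, U', S, hS, e', he'⟩ := exists_equiv_prod_of_pow_eq_one (K := K) hr hrF (T ^ k)
      (by rw [← pow_mul, mul_comm, pow_mul, hT, one_pow]) hTk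
    have hU' : Module.finrank F U = Module.finrank F K + Module.finrank F U' := by
      rw [e'.finrank_eq, Module.finrank_prod]
    have hS1 : S = 1 := by
      by_contra hS1
      obtain ⟨-, -, U'', -, -, e'', -⟩ := exists_equiv_prod_of_pow_eq_one (K := K) hr hrF S hS hS1
      have : Module.Free F U'' := Module.Free.of_divisionRing F U''
      have : Module.finrank F U' = Module.finrank F K + Module.finrank F U'' := by
        rw [e''.finrank_eq, Module.finrank_prod]
      omega
    subst hS1
    obtain ⟨j, -, hj, rfl⟩ := hζ.isPrimitiveRoot_iff.mp hν
    obtain ⟨σ, hσ⟩ := exists_equiv_mul_pow hζ.pow_eq_one hu (ZMod.unitOfCoprime j hj)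
      (ZMod.coe_unitOfCoprime j hj)
    let d : U' ≃ₗ[F]
        (Fin (Module.finrank F V - Module.finrank F K - Module.finrank F K) → F) :=
      LinearEquiv.ofFinrankEq _ _ (by rw [Module.finrank_fin_fun]; omega)
    refine ⟨some (ZMod.unitOfCoprime j hj : (ZMod r)ˣ),
      e.trans ((LinearEquiv.refl F K).prodCongr (e'.trans (σ.prodCongr d))), fun v => ?_⟩
    simp [hek, he', hσ]

open Matrix in
/-- Similar matrices of determinant one having a common block which is multiplication by an element
of a finite extension field are conjugate in the special linear group, as the norm is surjective. -/
theorem isConj_of_equiv_prod {F K W : Type*} [Field F] [Field K] [Finite K] [Algebra F K]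
    [FiniteDimensional F K] [AddCommGroup W] [Module F W] [FiniteDimensional F W] {n : ℕ}
    {ζ : K} {T : W → W} {g g' : SpecialLinearGroup (Fin n) F}
    (e e' : (Fin n → F) ≃ₗ[F] K × W)
    (he : ∀ v, e (toLin' g.1 v) = (ζ * (e v).1, T (e v).2))
    (he' : ∀ v, e' (toLin' g'.1 v) = (ζ * (e' v).1, T (e' v).2)) :
    ∃ h : SpecialLinearGroup (Fin n) F, h * g * h⁻¹ = g' := by
  obtain ⟨c, hc⟩ := FiniteField.norm_surjective F K (LinearEquiv.det (e.trans e'.symm))⁻¹.1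
  let m : Module.End F (K × W) := (LinearMap.mulLeft F c).prodMap LinearMap.id
  have hm : LinearMap.det m = Algebra.norm F c := by
    rw [LinearMap.det_prodMap, LinearMap.det_id, mul_one, Algebra.norm_apply]; rfl
  let D : Module.End F (Fin n → F) := e'.symm.toLinearMap ∘ₗ m ∘ₗ e.toLinearMap
  have hD : LinearMap.det D = 1 := by
    have : D = (e'.symm.toLinearMap ∘ₗ m ∘ₗ e'.symm.symm.toLinearMap) ∘ₗ
        (e.trans e'.symm).toLinearMap := by
      ext; simp [D]
    rw [this, LinearMap.det_comp, LinearMap.det_conj, hm, hc, ← LinearEquiv.coe_det]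
    exact Units.inv_mul _
  have hDg : ∀ v, D (toLin' g.1 v) = toLin' g'.1 (D v) := fun v => by
    apply e'.injective
    rw [he']
    simp [D, m, he, mul_left_comm, -toLin'_apply]
  let h : SpecialLinearGroup (Fin n) F :=
    ⟨LinearMap.toMatrix' D, by rw [LinearMap.det_toMatrix', hD]⟩
  refine ⟨h, ?_⟩
  rw [mul_inv_eq_iff_eq_mul]
  refine Matrix.SpecialLinearGroup.ext _ _ fun a b => congrFun₂ (toLin'.injective ?_) a b
  rw [Matrix.SpecialLinearGroup.coe_mul, Matrix.SpecialLinearGroup.coe_mul, toLin'_mul, toLin'_mul,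
    show toLin' h.1 = D from toLin'_toMatrix' D]
  exact LinearMap.ext hDg

open Pointwise in
theorem kappa_le_of_classification {J S : Type*} [Group J] [Finite S] {r : ℕ} (P : J → S → Prop)
    (hP : ∀ H : Subgroup J, Nat.card H = r → ∃ x s, Subgroup.zpowers x = H ∧ P x s)
    (hconj : ∀ x y s, P x s → P y s → ∃ h, h * x * h⁻¹ = y) : kappa J r ≤ Nat.card S := by
  have key : ∀ c : {c : Quotient (MulAction.orbitRel (ConjAct J) (Subgroup J)) //
      ∃ H : Subgroup J, Nat.card H = r ∧
        Quotient.mk (MulAction.orbitRel (ConjAct J) (Subgroup J)) H = c},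
      ∃ s x, P x s ∧
        Quotient.mk (MulAction.orbitRel (ConjAct J) (Subgroup J)) (Subgroup.zpowers x) = c := by
    rintro ⟨c, H, hH, rfl⟩
    obtain ⟨x, s, rfl, hs⟩ := hP H hH
    exact ⟨s, x, hs, rfl⟩
  choose φ x hx hc using key
  refine Nat.card_le_card_of_injective φ fun c d hcd => ?_
  apply Subtype.ext
  rw [← hc, ← hc]
  obtain ⟨h, hh⟩ := hconj (x d) (x c) (φ d) (hx d) (hcd ▸ hx c)
  refine Quotient.sound (MulAction.orbitRel_apply.mpr ⟨ConjAct.toConjAct h, ?_⟩)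
  change _ • Subgroup.zpowers (x d) = _
  rw [← hh]
  exact MonoidHom.map_zpowers (MulDistribMulAction.toMonoidHom J (ConjAct.toConjAct h)) (x d)

/-- Elements of order `r` lift along a quotient by a subgroup of exponent prime to `r`. -/
theorem exists_lift_orderOf {G : Type*} [Group G] {N : Subgroup G} [N.Normal] {r m : ℕ}
    (hr : r.Prime) (hm : m.Coprime r) (hN : ∀ z ∈ N, z ^ m = 1) {H : Subgroup (G ⧸ N)}
    (hH : Nat.card H = r) :
    ∃ g : G, g ^ r = 1 ∧ orderOf (g : G ⧸ N) = r ∧ (g : G ⧸ N) ∈ H := by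
  have : Fact r.Prime := ⟨hr⟩
  have := isCyclic_of_prime_card hH
  obtain ⟨⟨y, hyH⟩, hy⟩ := IsCyclic.exists_ofOrder_eq_natCard (α := H)
  rw [hH, Subgroup.orderOf_mk] at hy
  obtain ⟨g, rfl⟩ := QuotientGroup.mk_surjective y
  refine ⟨g ^ m, ?_, ?_, ?_⟩
  · rw [← pow_mul, mul_comm, pow_mul]
    apply hN
    rw [← QuotientGroup.eq_one_iff, QuotientGroup.mk_pow, ← hy, pow_orderOf_eq_one]
  · rw [QuotientGroup.mk_pow, Nat.Coprime.orderOf_pow (by rw [hy]; exact hm.symm), hy]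
  · exact H.pow_mem hyH m

theorem orderOf_card_unit_eq {q r i : ℕ} (hq : 0 < q) (u : (ZMod r)ˣ) (hu : (u : ZMod r) = q)
    (hi : 0 < i ∧ r ∣ q ^ i - 1 ∧ ∀ j, 0 < j → r ∣ q ^ j - 1 → i ≤ j) : orderOf u = i := by
  have h : ∀ j, r ∣ q ^ j - 1 ↔ u ^ j = 1 := fun j => by
    rw [← ZMod.natCast_eq_zero_iff, Nat.cast_sub (Nat.one_le_pow _ _ hq), ← Units.val_inj]
    simp [hu, sub_eq_zero]
  rw [orderOf_eq_iff hi.1, ← h]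
  exact ⟨hi.2.1, fun m hm h0 hm' => absurd (hi.2.2 m h0 ((h m).mpr hm')) (by omega)⟩

theorem dvd_card_pow_finrank_sub_one {F K : Type*} [Field F] [Fintype F] [Field K] [Algebra F K]
    [FiniteDimensional F K] {r : ℕ} (hr : r.Prime) {ζ : K}
    (hζ : IsPrimitiveRoot ζ r) :
    r ∣ Fintype.card F ^ Module.finrank F K - 1 := by
  have := Module.finite_of_finite F (M := K)
  have := Fintype.ofFinite K
  rw [← Module.card_eq_pow_finrank (K := F) (V := K)]
  apply hζ.dvd_of_pow_eq_one
  exact FiniteField.pow_card_sub_one_eq_one ζ (hζ.ne_zero hr.ne_zero)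

theorem pow_card_sub_one_eq_one_of_mem_center {F : Type*} [Field F] [Fintype F] {n : ℕ}
    (hn : n ≠ 0) {z : Matrix.SpecialLinearGroup (Fin n) F} (hz : z ∈ Subgroup.center _) :
    z ^ (Fintype.card F - 1) = 1 := by
  obtain ⟨c, hc, hz⟩ := Matrix.SpecialLinearGroup.mem_center_iff.mp hz
  have hc0 : c ≠ 0 := by
    rintro rfl
    rw [Fintype.card_fin, zero_pow hn] at hc
    exact zero_ne_one hc
  apply Subtype.ext
  rw [Matrix.SpecialLinearGroup.coe_pow, ← hz, ← map_pow,
    FiniteField.pow_card_sub_one_eq_one c hc0, map_one, Matrix.SpecialLinearGroup.coe_one]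

theorem kappa_projectiveSpecialLinearGroup_le {F K : Type*} [Field F] [Fintype F] [Field K]
    [Algebra F K] [FiniteDimensional F K] {n r : ℕ} (hn : n ≠ 0) (hr : r.Prime)
    (hrF : (r : F) ≠ 0) (hq1 : (Fintype.card F - 1).Coprime r) [IsCyclotomicExtension {r} F K]
    {ζ : K} (hζ : IsPrimitiveRoot ζ r) {u : (ZMod r)ˣ} (hu : (u : ZMod r) = Fintype.card F)
    (hdim : n < 3 * Module.finrank F K) :
    kappa (Matrix.ProjectiveSpecialLinearGroup (Fin n) F) r ≤
      Nat.card (Option ((ZMod r)ˣ ⧸ Subgroup.zpowers u)) := by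
  have : NeZero r := ⟨hr.ne_zero⟩
  have : Finite K := Module.finite_of_finite F
  rw [← Module.finrank_fin_fun (R := F) (n := n)] at hdim
  refine kappa_le_of_classification (fun x s =>
    ∃ g : Matrix.SpecialLinearGroup (Fin n) F,
      (g : Matrix.ProjectiveSpecialLinearGroup (Fin n) F) = x ∧
        HasNormalForm ζ u (Matrix.toLin' g.1) s) (fun H hH => ?_) ?_
  · obtain ⟨g, hg, hgo, hgH⟩ := exists_lift_orderOf hr hq1
      (fun z hz => pow_card_sub_one_eq_one_of_mem_center hn hz) hH
    have hf : Matrix.toLin' g.1 ^ r = 1 := by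
      rw [← Matrix.toLin'_pow, ← Matrix.SpecialLinearGroup.coe_pow, hg,
        Matrix.SpecialLinearGroup.coe_one, Matrix.toLin'_one]
      rfl
    have hf1 : Matrix.toLin' g.1 ≠ 1 := fun h => by
      have : g = 1 := Subtype.ext (Matrix.toLin'.injective (by
        rw [h, Matrix.SpecialLinearGroup.coe_one, Matrix.toLin'_one]; rfl))
      rw [this, QuotientGroup.mk_one, orderOf_one] at hgo
      exact hr.one_lt.ne hgo
    obtain ⟨k, hk, s, hs⟩ := exists_pow_hasNormalForm hr hrF hζ hu hdim _ hf hf1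
    refine ⟨_, s, ?_, g ^ k, rfl, ?_⟩
    · have : Finite H := Nat.finite_of_card_ne_zero (hH ▸ hr.ne_zero)
      apply Subgroup.eq_of_le_of_card_ge
      · rw [Subgroup.zpowers_le]
        exact H.pow_mem hgH k
      · rw [hH, Nat.card_zpowers, QuotientGroup.mk_pow,
          Nat.Coprime.orderOf_pow (by rw [hgo]; exact hk.symm), hgo]
    · rwa [Matrix.SpecialLinearGroup.coe_pow, Matrix.toLin'_pow]
  · rintro _ _ s ⟨g, rfl, hg⟩ ⟨g', rfl, hg'⟩
    obtain ⟨h, rfl⟩ : ∃ h, h * g * h⁻¹ = g' := by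
      cases s with
      | none =>
        obtain ⟨e, he⟩ := hg
        obtain ⟨e', he'⟩ := hg'
        exact isConj_of_equiv_prod (T := id) e e' he he'
      | some c =>
        obtain ⟨e, he⟩ := hg
        obtain ⟨e', he'⟩ := hg'
        exact isConj_of_equiv_prod
          (T := fun w => (ζ ^ (c.out : ZMod r).val * w.1, w.2)) e e' he he'
    exact ⟨h, rfl⟩

/-- Lemma 2.5(ii), linear case: for an odd prime `r` not dividing `q`, with `i ≥ 2` the
smallest positive integer such that `r ∣ q^i - 1` and `⌊n/i⌋ = 2`, we have `i ∣ r - 1`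
and `κ(PSL_n(q), r) ≤ (r-1)/i + 1`. -/
theorem stmt_5 {q n i : ℕ} (r : ℕ) (F : Type*) [Field F] [Fintype F]
    (hq : Fintype.card F = q) (hn : 2 ≤ n) (hr : r.Prime) (hodd : Odd r)
    (hrq : ¬ r ∣ q)
    (hi : 0 < i ∧ r ∣ q ^ i - 1 ∧ ∀ j, 0 < j → r ∣ q ^ j - 1 → i ≤ j)
    (hi2 : 2 ≤ i) (hfloor : n / i = 2) :
    i ∣ r - 1 ∧
      kappa (Matrix.ProjectiveSpecialLinearGroup (Fin n) F) r ≤ (r - 1) / i + 1 := by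
  subst hq
  have : Fact r.Prime := ⟨hr⟩
  have : NeZero r := ⟨hr.ne_zero⟩
  have hcop : (Fintype.card F).Coprime r := ((Nat.Prime.coprime_iff_not_dvd hr).mpr hrq).symm
  let u := ZMod.unitOfCoprime _ hcop
  have hu : (u : ZMod r) = Fintype.card F := ZMod.coe_unitOfCoprime _ hcop
  have hord : orderOf u = i := orderOf_card_unit_eq Fintype.card_pos u hu hi
  have hcard : r - 1 = Nat.card ((ZMod r)ˣ ⧸ Subgroup.zpowers u) * i := by
    rw [← hord, ← Nat.card_zpowers, ← Subgroup.card_eq_card_quotient_mul_card_subgroup,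
      Nat.card_eq_fintype_card, ZMod.card_units]
  have hrF : (r : F) ≠ 0 := fun h => by
    obtain ⟨p, hp⟩ := CharP.exists F
    obtain ⟨m, hpp, hm⟩ := FiniteField.card F p
    have h1 := (CharP.cast_eq_zero_iff F p r).mp h
    rw [(Nat.prime_dvd_prime_iff_eq hpp hr).mp h1] at hm
    rw [hm] at hrq
    exact hrq (dvd_pow_self r m.pos.ne')
  have : NeZero (r : F) := ⟨hrF⟩
  obtain ⟨K, _, _, _, _⟩ : ∃ (K : Type _) (_ : Field K) (_ : Algebra F K),
      FiniteDimensional F K ∧ IsCyclotomicExtension {r} F K :=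
    ⟨CyclotomicField r F, inferInstance, inferInstance,
      IsCyclotomicExtension.finiteDimensional {r} F _, inferInstance⟩
  have hζ := IsCyclotomicExtension.zeta_spec r F K
  have hdim : n < 3 * Module.finrank F K := by
    have h0 : r ∣ Fintype.card F ^ Module.finrank F K - 1 := dvd_card_pow_finrank_sub_one hr hζ
    have h1 : i ≤ Module.finrank F K := hi.2.2 _ Module.finrank_pos h0
    have h2 : n < (n / i + 1) * i := by
      rw [mul_comm]; exact Nat.lt_mul_div_succ n hi.1
    rw [hfloor] at h2
    omega
  have hq1 : (Fintype.card F - 1).Coprime r := by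
    refine ((Nat.Prime.coprime_iff_not_dvd hr).mpr fun h => ?_).symm
    have := hi.2.2 1 one_pos (by simpa using h)
    omega
  refine ⟨⟨_, by rw [hcard, mul_comm]⟩, ?_⟩
  rw [hcard, Nat.mul_div_cancel _ hi.1, ← Finite.card_option]
  exact kappa_projectiveSpecialLinearGroup_le (by omega) hr hrF hq1 hζ hu hdim
end

section
/- Let F_q be a finite field with q elements, let n ≥ 2, and let r be an odd prime not dividing q. Let i be the smallest positive integer such that r divides q^i − 1, and assume 2 ≤ i ≤ n. Then κ(PSL_n(q), r) ≥ ⌊n/i⌋. -/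
/-- A finite field of cardinality `q` with `r ∣ q ^ i - 1` has an extension of degree `i`
containing an element of order `r`. -/
theorem exists_extension_orderOf_eq {r i : ℕ} (hr : r.Prime) (hi : 0 < i)
    (F : Type*) [Field F] [Finite F] (hdvd : r ∣ Nat.card F ^ i - 1) :
    ∃ (K : Type) (_ : Field K) (_ : Finite K) (_ : Algebra F K),
      Module.finrank F K = i ∧ ∃ ζ : K, orderOf ζ = r := by
  obtain ⟨p, hp⟩ := CharP.exists F
  have : Fact p.Prime := ⟨CharP.char_is_prime F p⟩
  have : NeZero i := ⟨hi.ne'⟩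
  have : Fact r.Prime := ⟨hr⟩
  refine ⟨FiniteField.Extension F p i, inferInstance, inferInstance, inferInstance,
    FiniteField.finrank_extension F p i, ?_⟩
  obtain ⟨u, hu⟩ := exists_prime_orderOf_dvd_card' (G := (FiniteField.Extension F p i)ˣ) r (by
    rwa [Nat.card_units, FiniteField.natCard_extension])
  exact ⟨u, by rw [orderOf_units, hu]⟩

/-- If `r ∤ |F| - 1`, then `1` is the only `r`-th root of unity in the finite field `F`. -/
theorem eq_one_of_pow_prime_eq_one {r : ℕ} (hr : r.Prime) {F : Type*} [Field F] [Finite F]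
    (hdvd : ¬ r ∣ Nat.card F - 1) {x : F} (hx : x ^ r = 1) : x = 1 := by
  by_contra h
  have hx0 : x ≠ 0 := by
    rintro rfl
    simp [hr.ne_zero] at hx
  have : Fact r.Prime := ⟨hr⟩
  have ho : orderOf (Units.mk0 x hx0) = r :=
    orderOf_eq_prime (Units.ext (by simpa using hx)) (fun h1 ↦ h (by simpa using congr(($h1 : F))))
  apply hdvd
  rw [← Nat.card_units, ← ho]
  exact orderOf_dvd_natCard _

/-- The special linear group contains `r`-torsion elements whose powers of exponent prime to `r`
have a fixed space of codimension `k * i`. -/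
theorem exists_specialLinearGroup_card_fixed {r i n k : ℕ} (hr : r.Prime) (hi : 0 < i)
    (F : Type*) [Field F] [Finite F] (hdvd : r ∣ Nat.card F ^ i - 1)
    (hdvd1 : ¬ r ∣ Nat.card F - 1) (hk : k * i ≤ n) :
    ∃ g : Matrix.SpecialLinearGroup (Fin n) F, g ^ r = 1 ∧ ∀ m : ℕ, ¬ r ∣ m →
      Nat.card {v : Fin n → F // (g ^ m).1.mulVec v = v} = Nat.card F ^ (n - k * i) := by
  obtain ⟨K, _, _, _, hK, ζ, hζ⟩ := exists_extension_orderOf_eq hr hi F hdvd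
  let V := (Fin k → K) × (Fin (n - k * i) → F)
  have : Module.Finite F K := .of_finite
  have hV : Module.finrank F V = Module.finrank F (Fin n → F) := by
    simp only [V, Module.finrank_prod, Module.finrank_pi_fintype, hK, Finset.sum_const,
      Finset.card_univ, Fintype.card_fin, smul_eq_mul]
    simp
    omega
  let e : V ≃ₗ[F] (Fin n → F) := LinearEquiv.ofFinrankEq _ _ hV
  let f : Module.End F V :=
    LinearMap.prodMap (LinearMap.compLeft (LinearMap.mulLeft F ζ) (Fin k)) LinearMap.id
  have hf : ∀ (m : ℕ) (v : V), (f ^ m) v = (fun j ↦ ζ ^ m * v.1 j, v.2) := by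
    intro m
    induction m with
    | zero => intro v; simp
    | succ m ih =>
      intro v
      rw [pow_succ, Module.End.mul_apply, ih]
      ext j
      · change ζ ^ m * (ζ * v.1 j) = ζ ^ (m + 1) * v.1 j
        rw [pow_succ, mul_assoc]
      · rfl
  let A : Matrix (Fin n) (Fin n) F := LinearMap.toMatrixAlgEquiv' (e.conjRingEquiv f)
  have hA : ∀ (m : ℕ) (v : Fin n → F), (A ^ m).mulVec v = e ((f ^ m) (e.symm v)) := by
    intro m v
    have h1 : A ^ m = LinearMap.toMatrixAlgEquiv' (e.conjRingEquiv (f ^ m)) := by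
      rw [map_pow, map_pow]
    rw [h1, ← Matrix.toLinAlgEquiv'_apply, Matrix.toLinAlgEquiv'_toMatrixAlgEquiv']
    rfl
  have hAr : A ^ r = 1 := by
    have h1 : f ^ r = 1 := by
      ext1 <;> ext <;> simp [hf, ← hζ, pow_orderOf_eq_one]
    simp only [A, ← map_pow, h1, map_one]
  have hdet : A.det = 1 := by
    apply eq_one_of_pow_prime_eq_one hr hdvd1
    rw [← Matrix.det_pow, hAr, Matrix.det_one]
  let g : Matrix.SpecialLinearGroup (Fin n) F := ⟨A, hdet⟩
  have hg : ∀ m : ℕ, (g ^ m).1 = A ^ m := fun m ↦ Matrix.SpecialLinearGroup.coe_pow g m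
  refine ⟨g, Subtype.ext (by rw [hg, hAr, Matrix.SpecialLinearGroup.coe_one]), fun m hm ↦ ?_⟩
  simp only [hg]
  have hζm : ζ ^ m ≠ 1 := fun h ↦ hm (hζ ▸ orderOf_dvd_of_pow_eq_one h)
  have hfix : ∀ v : Fin n → F, (A ^ m).mulVec v = v ↔ (e.symm v).1 = 0 := by
    intro v
    rw [hA, ← LinearEquiv.eq_symm_apply, hf]
    constructor
    · intro h
      ext j
      have h1 : ζ ^ m * (e.symm v).1 j = (e.symm v).1 j := congr_fun (congr_arg Prod.fst h) j
      by_contra h0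
      exact hζm (mul_right_cancel₀ h0 (by rw [h1, one_mul]))
    · intro h
      ext j <;> simp [h]
  have e1 : {v : Fin n → F // (A ^ m).mulVec v = v} ≃ (Fin (n - k * i) → F) :=
    { toFun v := (e.symm v.1).2
      invFun w := ⟨e (0, w), by rw [hfix]; simp⟩
      left_inv v := by
        have h := (hfix v.1).1 v.2
        ext1
        simp only
        rw [← h]
        simp
      right_inv w := by simp }
  rw [Nat.card_congr e1, Nat.card_fun, Nat.card_fin]

/-- Conjugate matrices have equally many fixed vectors. -/
theorem card_fixed_eq_of_conj {n : ℕ} {F : Type*} [Field F]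
    (h a b : Matrix.SpecialLinearGroup (Fin n) F) (hab : h * a * h⁻¹ = b) :
    Nat.card {v : Fin n → F // a.1.mulVec v = v} =
      Nat.card {v : Fin n → F // b.1.mulVec v = v} := by
  have h1 : h.1 * a.1 = b.1 * h.1 := by
    rw [← Matrix.SpecialLinearGroup.coe_mul, ← Matrix.SpecialLinearGroup.coe_mul, ← hab]
    simp
  have h2 : a.1 * h⁻¹.1 = h⁻¹.1 * b.1 := by
    rw [← Matrix.SpecialLinearGroup.coe_mul, ← Matrix.SpecialLinearGroup.coe_mul, ← hab]
    simp [mul_assoc]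
  have h3 : h.1 * h⁻¹.1 = 1 := by
    rw [← Matrix.SpecialLinearGroup.coe_mul, mul_inv_cancel, Matrix.SpecialLinearGroup.coe_one]
  have h4 : h⁻¹.1 * h.1 = 1 := by
    rw [← Matrix.SpecialLinearGroup.coe_mul, inv_mul_cancel, Matrix.SpecialLinearGroup.coe_one]
  exact Nat.card_congr
    { toFun v := ⟨h.1.mulVec v.1, by
        rw [Matrix.mulVec_mulVec, ← h1, ← Matrix.mulVec_mulVec, v.2]⟩
      invFun v := ⟨h⁻¹.1.mulVec v.1, by
        rw [Matrix.mulVec_mulVec, h2, ← Matrix.mulVec_mulVec, v.2]⟩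
      left_inv v := Subtype.ext (by simp only [Matrix.mulVec_mulVec, h4, Matrix.one_mulVec])
      right_inv v := Subtype.ext (by simp only [Matrix.mulVec_mulVec, h3, Matrix.one_mulVec]) }

/-- If `r ∤ |F| - 1`, then the centre of `SL_n(F)` has no nontrivial `r`-torsion. -/
theorem eq_one_of_mem_center_of_pow_eq_one {n r : ℕ} (hr : r.Prime) {F : Type*} [Field F]
    [Finite F] (hn : 0 < n) (hdvd : ¬ r ∣ Nat.card F - 1)
    {z : Matrix.SpecialLinearGroup (Fin n) F}
    (hz : z ∈ Subgroup.center (Matrix.SpecialLinearGroup (Fin n) F)) (hzr : z ^ r = 1) :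
    z = 1 := by
  obtain ⟨c, -, hc⟩ := Matrix.SpecialLinearGroup.mem_center_iff.1 hz
  have h1 : z.1 ^ r = 1 := by
    rw [← Matrix.SpecialLinearGroup.coe_pow, hzr, Matrix.SpecialLinearGroup.coe_one]
  have : Nonempty (Fin n) := ⟨⟨0, hn⟩⟩
  have h2 : c ^ r = 1 := by
    rw [← hc, ← map_pow] at h1
    exact Matrix.scalar_inj.1 (h1.trans (map_one _).symm)
  apply Subtype.ext
  rw [← hc, eq_one_of_pow_prime_eq_one hr hdvd h2, map_one, Matrix.SpecialLinearGroup.coe_one]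

/-- If the central quotient of `G` by a centre without `r`-torsion identifies a conjugate of `a`
with `b`, where both are `r`-torsion, then `a` and `b` are already conjugate by the same element. -/
theorem conj_eq_of_mk_conj_eq {G : Type*} [Group G] {r : ℕ}
    (hG : ∀ z ∈ Subgroup.center G, z ^ r = 1 → z = 1) {a b h : G} (ha : a ^ r = 1)
    (hb : b ^ r = 1)
    (hab : (h * a * h⁻¹ : G) = ((b : G) : G ⧸ Subgroup.center G)) : h * a * h⁻¹ = b := by
  have hz := QuotientGroup.eq.1 hab
  have h1 : (h * a * h⁻¹) ^ r = 1 := by rw [conj_pow, ha]; simp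
  have hcomm : Commute (h * a * h⁻¹) ((h * a * h⁻¹)⁻¹ * b) :=
    Subgroup.mem_center_iff.1 hz _
  have h2 := hG _ hz (by
    have h3 := hcomm.mul_pow r
    rw [mul_inv_cancel_left, hb, h1, one_mul] at h3
    exact h3.symm)
  exact inv_mul_eq_one.1 h2

open Pointwise in
/-- Elements of order `r`, none of which is conjugate to a power of another one, generate
pairwise non-conjugate subgroups of order `r`. -/
theorem le_kappa {J : Type*} [Group J] [Finite J] {r N : ℕ} (g : Fin N → J)
    (hord : ∀ k, orderOf (g k) = r)
    (hconj : ∀ (k l : Fin N) (x : J) (m : ℕ), x * g l * x⁻¹ = g k ^ m → k = l) :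
    N ≤ kappa J r := by
  let c : Fin N → {c : Quotient (MulAction.orbitRel (ConjAct J) (Subgroup J)) //
      ∃ H : Subgroup J, Nat.card H = r ∧
        Quotient.mk (MulAction.orbitRel (ConjAct J) (Subgroup J)) H = c} := fun k ↦
    ⟨Quotient.mk _ (Subgroup.zpowers (g k)), _, by rw [Nat.card_zpowers, hord], rfl⟩
  have hc : Function.Injective c := by
    intro k l hkl
    obtain ⟨x, hx⟩ := MulAction.orbitRel_apply.1 (Quotient.exact (congr_arg Subtype.val hkl))
    have hmem : x • g l ∈ x • Subgroup.zpowers (g l) :=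
      Subgroup.smul_mem_pointwise_smul _ _ _ (Subgroup.mem_zpowers _)
    have hx' : x • Subgroup.zpowers (g l) = Subgroup.zpowers (g k) := hx
    rw [hx', ConjAct.smul_def] at hmem
    obtain ⟨m, hm⟩ := mem_powers_iff_mem_zpowers.2 hmem
    exact hconj k l _ m hm.symm
  simpa [kappa] using Nat.card_le_card_of_injective c hc

/-- Lemma 2.5(iii), linear case: for an odd prime `r` not dividing `q`, with `i` the
smallest positive integer such that `r ∣ q^i - 1` and `2 ≤ i ≤ n`, we have
`κ(PSL_n(q), r) ≥ ⌊n/i⌋`. -/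
theorem stmt_6 {q n i : ℕ} (r : ℕ) (F : Type*) [Field F] [Fintype F]
    (hq : Fintype.card F = q) (hn : 2 ≤ n) (hr : r.Prime) (hodd : Odd r)
    (hrq : ¬ r ∣ q)
    (hi : 0 < i ∧ r ∣ q ^ i - 1 ∧ ∀ j, 0 < j → r ∣ q ^ j - 1 → i ≤ j)
    (hi2 : 2 ≤ i) (hin : i ≤ n) :
    n / i ≤ kappa (Matrix.ProjectiveSpecialLinearGroup (Fin n) F) r := by
  subst hq
  have hir : r ∣ Nat.card F ^ i - 1 := by
    rw [Nat.card_eq_fintype_card]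
    exact hi.2.1
  have h1 : ¬ r ∣ Nat.card F - 1 := by
    rw [Nat.card_eq_fintype_card]
    intro h
    have := hi.2.2 1 one_pos (by simpa using h)
    omega
  have hr0 : Fact r.Prime := ⟨hr⟩
  have hcenter : ∀ z ∈ Subgroup.center (Matrix.SpecialLinearGroup (Fin n) F), z ^ r = 1 → z = 1 :=
    fun z hz hzr ↦ eq_one_of_mem_center_of_pow_eq_one hr (by omega) h1 hz hzr
  have hki : ∀ k : Fin (n / i), (k.1 + 1) * i ≤ n := fun k ↦
    (Nat.mul_le_mul_right i k.2).trans (Nat.div_mul_le_self n i)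
  have hpos : ∀ k : Fin (n / i), 0 < (k.1 + 1) * i := fun k ↦ Nat.mul_pos k.1.succ_pos hi.1
  choose g hgr hg using fun k : Fin (n / i) ↦
    exists_specialLinearGroup_card_fixed hr hi.1 F hir h1 (hki k)
  have hcard : 1 < Nat.card F := Finite.one_lt_card
  have hone : ¬ r ∣ 1 := hr.one_lt.ne' ∘ Nat.dvd_one.1
  have hg1 : ∀ k, g k ≠ 1 := by
    intro k hk
    have h2 := hg k 1 hone
    rw [hk] at h2
    simp only [one_pow, Matrix.SpecialLinearGroup.coe_one, Matrix.one_mulVec] at h2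
    rw [Nat.card_congr (Equiv.subtypeUnivEquiv fun _ ↦ trivial), Nat.card_fun, Nat.card_fin] at h2
    have h3 := Nat.pow_right_injective hcard h2
    have h4 := hki k
    have h5 := hpos k
    omega
  let P := Matrix.ProjectiveSpecialLinearGroup (Fin n) F
  let π : Matrix.SpecialLinearGroup (Fin n) F →* P := QuotientGroup.mk' _
  have hord : ∀ k, orderOf (π (g k)) = r := by
    intro k
    refine orderOf_eq_prime (by rw [← map_pow, hgr, map_one]) fun h ↦ hg1 k ?_
    exact hcenter _ ((QuotientGroup.eq_one_iff _).1 h) (hgr k)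
  have hfin : Finite P := Quotient.finite _
  refine le_kappa (fun k ↦ π (g k)) hord fun k l x m hm ↦ ?_
  obtain ⟨h, rfl⟩ := QuotientGroup.mk'_surjective _ x
  have hconj : h * g l * h⁻¹ = g k ^ m :=
    conj_eq_of_mk_conj_eq hcenter (hgr l)
      (by rw [← pow_mul, mul_comm, pow_mul, hgr, one_pow]) hm
  have hrm : ¬ r ∣ m := by
    rintro ⟨s, rfl⟩
    rw [pow_mul, hgr, one_pow, conj_eq_one_iff] at hconj
    exact hg1 l hconj
  have h2 := card_fixed_eq_of_conj _ _ _ hconj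
  have h3 := hg l 1 hone
  rw [pow_one] at h3
  rw [hg k m hrm, h3] at h2
  have h4 := Nat.pow_right_injective hcard h2
  have h5 : (l.1 + 1) * i = (k.1 + 1) * i := by
    have := hki k
    have := hki l
    omega
  have h6 := Nat.eq_of_mul_eq_mul_right hi.1 h5
  exact Fin.ext (by omega)
end

section
/- Let F_q be a finite field with q elements and let r ≥ 5 be a prime dividing q − 1. Then κ(PSL_3(q), r) ≤ r − 1. -/
open Polynomial in
/-- An endomorphism annihilated by a product of distinct linear factors has eigenvectors spanning
the whole space. -/
theorem Module.End.span_eigenvectors_eq_top {K V : Type*} [Field K] [AddCommGroup V] [Module K V]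
    (f : Module.End K V) (s : Finset K) (hf : aeval f (∏ a ∈ s, (X - C a)) = 0) :
    Submodule.span K {v | ∃ a ∈ s, f v = a • v} = ⊤ := by
  classical
  have ker_le : ∀ t ⊆ s, LinearMap.ker (aeval f (∏ a ∈ t, (X - C a))) ≤
      Submodule.span K {v | ∃ a ∈ s, f v = a • v} := by
    intro t
    induction t using Finset.induction_on with
    | empty => simp [Module.End.one_eq_id, LinearMap.ker_id]
    | insert a t hat ih =>
      intro hts
      rw [Finset.insert_subset_iff] at hts
      rw [Finset.prod_insert hat, ← sup_ker_aeval_eq_ker_aeval_mul_of_coprime]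
      · refine sup_le (fun v hv ↦ Submodule.subset_span ⟨a, hts.1, ?_⟩) (ih hts.2)
        simpa [sub_eq_zero, Module.algebraMap_end_apply] using hv
      · refine IsCoprime.prod_right fun b hb ↦ isCoprime_X_sub_C_of_isUnit_sub ?_
        exact (sub_ne_zero.mpr (ne_of_mem_of_not_mem hb hat).symm).isUnit
  simpa [hf] using ker_le s subset_rfl

/-- A matrix of finite order `r` over a field with a primitive `r`-th root of unity is
diagonalizable, with `r`-th roots of unity as eigenvalues. -/
theorem Matrix.exists_mul_eq_mul_diagonal_of_pow_eq_one {K : Type*} [Field K] {n r : ℕ} {ζ : K}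
    (hr : 0 < r) (hζ : IsPrimitiveRoot ζ r) (A : Matrix (Fin n) (Fin n) K) (hA : A ^ r = 1) :
    ∃ (Q : Matrix (Fin n) (Fin n) K) (d : Fin n → K),
      IsUnit Q ∧ (∀ i, d i ^ r = 1) ∧ A * Q = Q * Matrix.diagonal d := by
  have span_eq := Module.End.span_eigenvectors_eq_top (Matrix.toLin' A)
    (Polynomial.nthRootsFinset r 1) (by
      rw [← Polynomial.X_pow_sub_one_eq_prod hr hζ]
      simp [← Matrix.toLin'_pow, hA, Module.End.one_eq_id])
  obtain ⟨b, b_mem, -, b_indep⟩ := Submodule.exists_fun_fin_finrank_span_eq K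
    {v | ∃ a ∈ Polynomial.nthRootsFinset r (1 : K), Matrix.toLin' A v = a • v}
  have finrank_eq : Module.finrank K (Submodule.span K
      {v | ∃ a ∈ Polynomial.nthRootsFinset r (1 : K), Matrix.toLin' A v = a • v}) = n := by
    rw [span_eq, finrank_top, Module.finrank_fin_fun]
  generalize Module.finrank K (Submodule.span K
      {v | ∃ a ∈ Polynomial.nthRootsFinset r (1 : K), Matrix.toLin' A v = a • v}) = m at *
  subst finrank_eq
  choose d d_mem hd using b_mem
  refine ⟨(Matrix.of b).transpose, d, ?_, fun i ↦ ?_, ?_⟩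
  · rw [← Matrix.linearIndependent_cols_iff_isUnit]
    exact b_indep
  · exact (Polynomial.mem_nthRootsFinset hr 1).mp (d_mem i)
  · ext i j
    rw [Matrix.mul_diagonal, mul_comm]
    exact congrFun (hd j) i

/-- A diagonalizing matrix can be rescaled to have determinant one. -/
theorem Matrix.SpecialLinearGroup.exists_mul_eq_mul_diagonal {n K : Type*} [Field K] [Fintype n]
    [DecidableEq n] [Nonempty n] {A Q : Matrix n n K} {d : n → K} (hQ : IsUnit Q)
    (h : A * Q = Q * Matrix.diagonal d) :
    ∃ P : Matrix.SpecialLinearGroup n K, A * P.1 = P.1 * Matrix.diagonal d := by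
  obtain ⟨i⟩ := ‹Nonempty n›
  have det_ne : Q.det ≠ 0 := ((Matrix.isUnit_iff_isUnit_det Q).mp hQ).ne_zero
  refine ⟨⟨Q * Matrix.diagonal (Function.update 1 i Q.det⁻¹), ?_⟩, ?_⟩
  · rw [Matrix.det_mul, Matrix.det_diagonal, Finset.prod_update_of_mem (Finset.mem_univ i)]
    simp [det_ne]
  · simp only
    rw [← mul_assoc, h, mul_assoc, mul_assoc, Matrix.diagonal_mul_diagonal,
      Matrix.diagonal_mul_diagonal]
    simp_rw [mul_comm]

/-- The diagonal matrix with entries `a`, `b`, `(a * b)⁻¹`. -/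
def Matrix.SpecialLinearGroup.diag₃ {K : Type*} [Field K] (a b : Kˣ) :
    Matrix.SpecialLinearGroup (Fin 3) K :=
  ⟨Matrix.diagonal ![(a : K), b, ((a * b)⁻¹ : Kˣ)], by
    simp [Matrix.det_diagonal, Fin.prod_univ_three]; field_simp⟩

/-- Some power of an element of prime order `r` in `SL₃(K)` is conjugate to
`diag(ζ, ζ ^ t, ζ ^ (-1 - t))` with `t < r - 1`. -/
theorem Matrix.SpecialLinearGroup.exists_pow_mul_eq_mul_diag₃ {K : Type*} [Field K] {r : ℕ}
    (hr : r.Prime) {ζ : Kˣ} (hζ : IsPrimitiveRoot ζ r)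
    (M : Matrix.SpecialLinearGroup (Fin 3) K) (hM : M ^ r = 1) (hM1 : M ≠ 1) :
    ∃ k, ∃ t < r - 1, ∃ P, M ^ k * P = P * diag₃ ζ (ζ ^ t) := by
  have hζK : IsPrimitiveRoot (ζ : K) r := IsPrimitiveRoot.coe_units_iff.mpr hζ
  have : NeZero r := ⟨hr.ne_zero⟩
  obtain ⟨Q, d, hQ, d_pow, hMQ⟩ := Matrix.exists_mul_eq_mul_diagonal_of_pow_eq_one hr.pos hζK
    M.1 (by simpa using congrArg Subtype.val hM)
  have det_eq : ∏ i, d i = 1 := by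
    have := congrArg Matrix.det hMQ
    rw [Matrix.det_mul, Matrix.det_mul, M.2, mul_comm, Matrix.det_diagonal] at this
    exact (mul_left_cancel₀ ((Matrix.isUnit_iff_isUnit_det Q).mp hQ).ne_zero this).symm
  obtain ⟨i, hi⟩ : ∃ i, d i ≠ 1 := by
    by_contra! h
    apply hM1
    have : M.1 * Q = 1 * Q := by
      rw [hMQ, funext h]; simp
    exact Subtype.ext (hQ.mul_right_cancel this)
  have hdi : IsPrimitiveRoot (d i) r := by
    have := Fact.mk hr
    exact IsPrimitiveRoot.iff_orderOf.mpr (orderOf_eq_prime (d_pow i) hi)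
  obtain ⟨k, -, hk⟩ := hdi.eq_pow_of_pow_eq_one hζK.pow_eq_one
  choose t t_lt ht using fun j ↦
    hζK.eq_pow_of_pow_eq_one (show (d j ^ k) ^ r = 1 by rw [pow_right_comm, d_pow, one_pow])
  have pow_mul : ∀ k : ℕ, M.1 ^ k * Q = Q * Matrix.diagonal (d ^ k) := by
    intro k
    induction k with
    | zero => simp
    | succ k ih =>
      rw [pow_succ, mul_assoc, hMQ, ← mul_assoc, ih, mul_assoc, Matrix.diagonal_mul_diagonal,
        pow_succ d]
      rfl
  have exists_perm : ∀ i : Fin 3, ∃ σ τ : Equiv.Perm (Fin 3), σ 0 = i ∧ τ 0 = i ∧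
      σ 1 = τ 2 ∧ σ 2 = τ 1 := by decide
  have prod_perm : ∀ σ : Equiv.Perm (Fin 3), d (σ 0) * d (σ 1) * d (σ 2) = 1 := by
    intro σ
    rw [← det_eq, ← Equiv.prod_comp σ, Fin.prod_univ_three]
  have prod_pow_eq_one : ∀ σ : Equiv.Perm (Fin 3), σ 0 = i →
      (ζ : K) * (ζ : K) ^ t (σ 1) * (ζ : K) ^ t (σ 2) = 1 := by
    rintro σ rfl
    rw [ht, ht, ← hk, ← mul_pow, ← mul_pow, prod_perm, one_pow]
  obtain ⟨σ, hσ, hσt⟩ : ∃ σ : Equiv.Perm (Fin 3), σ 0 = i ∧ t (σ 1) < r - 1 := by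
    obtain ⟨σ, τ, hσ, hτ, h₁, h₂⟩ := exists_perm i
    by_contra! h
    have hσt := h σ hσ
    have hτt := h τ hτ
    have := t_lt (σ 1)
    have := t_lt (τ 1)
    have prod_pow : (ζ : K) ^ (1 + (r - 1) + (r - 1)) = 1 := by
      have h1 : r - 1 = t (σ 1) := by omega
      have h2 : r - 1 = t (σ 2) := by rw [h₂]; omega
      rw [pow_add, pow_add, pow_one]
      nth_rewrite 1 [h1]
      rw [h2, prod_pow_eq_one σ hσ]
    have := (hζK.pow_eq_one_iff_dvd _).mp prod_pow
    rw [show 1 + (r - 1) + (r - 1) = r + (r - 1) by have := hr.pos; omega,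
      Nat.dvd_add_right dvd_rfl] at this
    have := Nat.le_of_dvd (by have := hr.two_le; omega) this
    have := hr.pos
    omega
  obtain ⟨P, hP⟩ := Matrix.SpecialLinearGroup.exists_mul_eq_mul_diagonal
    (A := M.1 ^ k) (Q := Q.submatrix id σ) (d := (d ^ k) ∘ σ) (by
      rw [Matrix.isUnit_iff_isUnit_det, Matrix.det_permute']
      exact ((Units.isUnit _).map (Int.castRingHom K)).mul
        ((Matrix.isUnit_iff_isUnit_det Q).mp hQ)) (by
      ext a b
      simpa [Matrix.mul_apply, Matrix.diagonal_apply] using congrFun₂ (pow_mul k) a (σ b))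
  refine ⟨k, t (σ 1), hσt, P, Subtype.ext ?_⟩
  have entries : (d ^ k) ∘ σ = ![(ζ : K), (ζ ^ t (σ 1) : Kˣ), ((ζ * ζ ^ t (σ 1))⁻¹ : Kˣ)] := by
    funext j
    fin_cases j
    · simp [hσ, hk]
    · simp [ht]
    · have : (ζ : K) * ζ ^ t (σ 1) * d (σ 2) ^ k = 1 := by
        rw [← ht (σ 2), prod_pow_eq_one σ hσ]
      simpa [mul_inv_rev] using eq_inv_of_mul_eq_one_right this
  rw [entries] at hP
  rw [coe_mul, coe_mul, coe_pow]
  exact hP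

open Pointwise in
theorem kappa_le_of_forall_exists_conj {J : Type*} [Group J] {r n : ℕ} (L : Fin n → Subgroup J)
    (h : ∀ H : Subgroup J, Nat.card H = r → ∃ t, ∃ g : ConjAct J, g • L t = H) :
    kappa J r ≤ n := by
  let f : Fin n → Quotient (MulAction.orbitRel (ConjAct J) (Subgroup J)) :=
    fun t ↦ Quotient.mk _ (L t)
  have subset_range : {c | ∃ H : Subgroup J, Nat.card H = r ∧
      Quotient.mk (MulAction.orbitRel (ConjAct J) (Subgroup J)) H = c} ⊆ Set.range f := by
    rintro _ ⟨H, hH, rfl⟩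
    obtain ⟨t, g, hg⟩ := h H hH
    exact ⟨t, (Quotient.sound (MulAction.orbitRel_apply.mpr ⟨g, hg⟩)).symm⟩
  calc kappa J r ≤ Nat.card (Set.range f) := Nat.card_mono (Set.finite_range f) subset_range
    _ ≤ n := by simpa using Finite.card_range_le f

open Pointwise in
theorem ConjAct.smul_zpowers {G : Type*} [Group G] (g : ConjAct G) (x : G) :
    g • Subgroup.zpowers x = Subgroup.zpowers (g • x) :=
  MonoidHom.map_zpowers (MulDistribMulAction.toMonoidHom G g) x

open Pointwise in
/-- Every subgroup of prime order `r ≠ 3` of `PSL₃(K)` is conjugate to one generated by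
`diag(ζ, ζ ^ t, ζ ^ (-1 - t))` with `t < r - 1`. -/
theorem Matrix.ProjectiveSpecialLinearGroup.exists_conj_zpowers_diag₃ {K : Type*} [Field K] {r : ℕ}
    (hr : r.Prime) (hr3 : r ≠ 3) {ζ : Kˣ} (hζ : IsPrimitiveRoot ζ r)
    (H : Subgroup (Matrix.ProjectiveSpecialLinearGroup (Fin 3) K)) (hH : Nat.card H = r) :
    ∃ t < r - 1, ∃ g : ConjAct (Matrix.ProjectiveSpecialLinearGroup (Fin 3) K),
      g • Subgroup.zpowers (QuotientGroup.mk (SpecialLinearGroup.diag₃ ζ (ζ ^ t)) :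
        Matrix.ProjectiveSpecialLinearGroup (Fin 3) K) = H := by
  have := Fact.mk hr
  have zpowers_eq : ∀ x ∈ H, x ≠ 1 → Subgroup.zpowers x = H := by
    intro x hx hx1
    have := zpowers_eq_top_of_prime_card hH (g := ⟨x, hx⟩) (by simpa using hx1)
    simpa [MonoidHom.map_zpowers, ← MonoidHom.range_eq_map] using
      congrArg (Subgroup.map H.subtype) this
  obtain ⟨x, hx, hx1⟩ : ∃ x ∈ H, x ≠ 1 := by
    by_contra! h
    rw [(Subgroup.eq_bot_iff_forall H).mpr h, Subgroup.card_bot] at hH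
    exact hr.ne_one hH.symm
  have x_pow : x ^ r = 1 := by
    have := pow_card_eq_one' (x := (⟨x, hx⟩ : H))
    rw [hH] at this
    simpa using congrArg Subtype.val this
  obtain ⟨y, rfl⟩ := QuotientGroup.mk_surjective x
  obtain ⟨a, ha, hya⟩ := Matrix.SpecialLinearGroup.mem_center_iff.mp
    ((QuotientGroup.eq_one_iff (y ^ r)).mp x_pow)
  have y_pow : (y ^ 3) ^ r = 1 := by
    rw [pow_right_comm]
    apply Subtype.ext
    rw [Matrix.SpecialLinearGroup.coe_pow, ← hya, ← map_pow, show a ^ 3 = 1 by simpa using ha,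
      map_one, Matrix.SpecialLinearGroup.coe_one]
  have mk_ne : (QuotientGroup.mk (y ^ 3) : Matrix.ProjectiveSpecialLinearGroup (Fin 3) K) ≠ 1 := by
    intro h
    have : orderOf (QuotientGroup.mk y : Matrix.ProjectiveSpecialLinearGroup (Fin 3) K) = r :=
      orderOf_eq_prime x_pow hx1
    exact hr3 ((Nat.prime_dvd_prime_iff_eq hr Nat.prime_three).mp
      (this ▸ orderOf_dvd_of_pow_eq_one h))
  obtain ⟨k, t, ht, P, hP⟩ := SpecialLinearGroup.exists_pow_mul_eq_mul_diag₃ hr hζ (y ^ 3) y_pow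
    (fun h ↦ mk_ne (by rw [h]; rfl))
  have mk_pow_ne : (QuotientGroup.mk ((y ^ 3) ^ k) :
      Matrix.ProjectiveSpecialLinearGroup (Fin 3) K) ≠ 1 := by
    intro h
    have order_eq : orderOf (QuotientGroup.mk (y ^ 3) :
        Matrix.ProjectiveSpecialLinearGroup (Fin 3) K) = r :=
      orderOf_eq_prime (by rw [← QuotientGroup.mk_pow, y_pow]; rfl) mk_ne
    obtain ⟨m, rfl⟩ : r ∣ k := order_eq ▸ orderOf_dvd_of_pow_eq_one h
    rw [pow_mul, y_pow, one_pow, one_mul, left_eq_mul] at hP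
    have := congrFun₂ (congrArg Subtype.val hP) 0 0
    simp [SpecialLinearGroup.diag₃] at this
    exact hζ.ne_one hr.one_lt this
  refine ⟨t, ht, ConjAct.toConjAct (QuotientGroup.mk P), ?_⟩
  rw [← zpowers_eq _ (show QuotientGroup.mk ((y ^ 3) ^ k) ∈ H from pow_mem (pow_mem hx 3) k)
    mk_pow_ne, eq_mul_inv_of_mul_eq hP, ConjAct.smul_zpowers]
  rfl

/-- Lemma 2.9(i), linear case: if `r ≥ 5` is a prime dividing `q - 1`, then
`κ(PSL_3(q), r) ≤ r - 1`. -/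
theorem stmt_7 {q : ℕ} (r : ℕ) (F : Type*) [Field F] [Fintype F]
    (hq : Fintype.card F = q) (hr : r.Prime) (hr5 : 5 ≤ r) (hdvd : r ∣ q - 1) :
    kappa (Matrix.ProjectiveSpecialLinearGroup (Fin 3) F) r ≤ r - 1 := by
  classical
  have := Fact.mk hr
  obtain ⟨ζ, hζ⟩ := exists_prime_orderOf_dvd_card (G := Fˣ) r
    (by rwa [Fintype.card_units, hq])
  refine kappa_le_of_forall_exists_conj (fun t : Fin (r - 1) ↦ Subgroup.zpowers
    (QuotientGroup.mk (Matrix.SpecialLinearGroup.diag₃ ζ (ζ ^ (t : ℕ))))) fun H hH ↦ ?_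
  obtain ⟨t, ht, g, hg⟩ := Matrix.ProjectiveSpecialLinearGroup.exists_conj_zpowers_diag₃ hr
    (by omega) (IsPrimitiveRoot.iff_orderOf.mpr hζ) H hH
  exact ⟨⟨t, ht⟩, g, hg⟩
end

section
/- Let F_q be a finite field with q elements and let r ≥ 5 be a prime dividing q + 1. Then 8·κ(PSL_6(q), r) ≤ r² + 15. -/
/-- The pairs `i < j ≤ r / 2`, together with `(0, 0)` and `(1, 1)`. -/
def sortedPairs (r : ℕ) : Finset (ℕ × ℕ) :=
  ((Finset.range (r / 2 + 1)).sigma Finset.range).image (fun x => (x.2, x.1)) ∪ {(0, 0), (1, 1)}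

theorem card_sortedPairs_le {r : ℕ} (hr : Odd r) : 8 * (sortedPairs r).card ≤ r ^ 2 + 15 := by
  obtain ⟨m, rfl⟩ := hr
  have h1 : (sortedPairs (2 * m + 1)).card ≤ ∑ j ∈ Finset.range (m + 1), j + 2 := by
    refine (Finset.card_union_le _ _).trans ?_
    gcongr
    · refine Finset.card_image_le.trans ?_
      rw [Finset.card_sigma]
      simp [show (2 * m + 1) / 2 = m by omega]
    · exact Finset.card_le_two
  have h2 := Finset.sum_range_id_mul_two (m + 1)
  simp only [Nat.add_sub_cancel] at h2
  nlinarith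

theorem ZMod.exists_natCast_eq_or_neg_eq {r : ℕ} [NeZero r] (a : ZMod r) :
    ∃ i : ℕ, i ≤ r / 2 ∧ ((i : ZMod r) = a ∨ (i : ZMod r) = -a) := by
  refine ⟨a.valMinAbs.natAbs, ZMod.natAbs_valMinAbs_le a, ?_⟩
  have h := Int.natAbs_eq a.valMinAbs
  have hc := ZMod.coe_valMinAbs a
  generalize a.valMinAbs.natAbs = i at h
  rcases h with h | h <;> rw [h] at hc <;> push_cast at hc
  · exact .inl hc
  · exact .inr (by rw [← hc, neg_neg])

/-- Triples in `ZMod r`, up to permutations, sign changes of the entries and scaling. -/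
theorem exists_card_le_image_of_symmetric {r : ℕ} (hr : r.Prime) (hr5 : 5 ≤ r) {α : Type*}
    (f : ZMod r → ZMod r → ZMod r → α)
    (swap₁ : ∀ a b c, f a b c = f b a c) (swap₂ : ∀ a b c, f a b c = f a c b)
    (neg : ∀ a b c, f (-a) b c = f a b c)
    (scale : ∀ k a b c, k ≠ 0 → f (k * a) (k * b) (k * c) = f a b c) :
    ∃ S : Finset α, 8 * S.card ≤ r ^ 2 + 15 ∧
      ∀ a b c, ¬ (a = 0 ∧ b = 0 ∧ c = 0) → f a b c ∈ S := by
  classical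
  have : Fact r.Prime := ⟨hr⟩
  have neg₂ : ∀ a b c, f a (-b) c = f a b c := fun a b c => by
    rw [swap₁, neg, swap₁]
  have neg₃ : ∀ a b c, f a b (-c) = f a b c := fun a b c => by
    rw [swap₂, neg₂, swap₂]
  set g : ℕ × ℕ → α := fun x => f 1 x.1 x.2 with hg
  refine ⟨(sortedPairs r).image g, ?_, ?_⟩
  · have := card_sortedPairs_le (hr.odd_of_ne_two (by omega))
    have := Finset.card_image_le (s := sortedPairs r) (f := g)
    omega
  have mem_of_lt : ∀ i j : ℕ, i < j → j ≤ r / 2 → f 1 i j ∈ (sortedPairs r).image g := by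
    intro i j hij hj
    refine Finset.mem_image.2 ⟨(i, j), ?_, rfl⟩
    refine Finset.mem_union_left _ (Finset.mem_image.2 ⟨⟨j, i⟩, ?_, rfl⟩)
    simp; omega
  have mem_one_one : ∀ a : ZMod r, f 1 1 a ∈ (sortedPairs r).image g := by
    intro a
    obtain ⟨i, hi, h⟩ := ZMod.exists_natCast_eq_or_neg_eq a
    have e : f 1 1 a = f 1 1 i := by
      rcases h with h | h
      · rw [h]
      · rw [h, neg₃]
    rw [e]
    rcases lt_trichotomy i 1 with h | h | h
    · have := mem_of_lt i 1 h (by omega)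
      rw [swap₂]; simpa using this
    · subst h
      exact Finset.mem_image.2 ⟨(1, 1), by simp [sortedPairs], by simp [hg]⟩
    · have := mem_of_lt 1 i h hi
      simpa using this
  have mem_le : ∀ i j : ℕ, i ≤ j → j ≤ r / 2 → f 1 i j ∈ (sortedPairs r).image g := by
    intro i j hij hj
    rcases hij.lt_or_eq with h | rfl
    · exact mem_of_lt i j h hj
    · rcases Nat.eq_zero_or_pos i with rfl | hi
      · exact Finset.mem_image.2 ⟨(0, 0), by simp [sortedPairs], by simp [hg]⟩
      · have hi0 : (i : ZMod r) ≠ 0 := by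
          rw [Ne, ZMod.natCast_eq_zero_iff]
          intro hd
          have := Nat.le_of_dvd hi hd
          omega
        have := scale (i : ZMod r)⁻¹ 1 i i (inv_ne_zero hi0)
        rw [inv_mul_cancel₀ hi0, swap₁, swap₂] at this
        rw [← this]
        exact mem_one_one _
  have mem_one : ∀ b c, f 1 b c ∈ (sortedPairs r).image g := by
    intro b c
    obtain ⟨i, hi, h⟩ := ZMod.exists_natCast_eq_or_neg_eq b
    obtain ⟨j, hj, h'⟩ := ZMod.exists_natCast_eq_or_neg_eq c
    have e : f 1 b c = f 1 i j := by
      rcases h with h | h <;> rcases h' with h' | h' <;> simp only [h, h', neg₂, neg₃]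
    rw [e]
    rcases le_total i j with h | h
    · exact mem_le i j h hj
    · rw [swap₂]; exact mem_le j i h hi
  have mem_ne : ∀ a b c, a ≠ 0 → f a b c ∈ (sortedPairs r).image g := by
    intro a b c ha
    have := scale a⁻¹ a b c (inv_ne_zero ha)
    rw [inv_mul_cancel₀ ha] at this
    rw [← this]
    exact mem_one _ _
  intro a b c h
  by_cases ha : a = 0
  · by_cases hb : b = 0
    · have hc : c ≠ 0 := fun hc => h ⟨ha, hb, hc⟩
      rw [swap₂, swap₁]; exact mem_ne _ _ _ hc
    · rw [swap₁]; exact mem_ne _ _ _ hb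
  · exact mem_ne _ _ _ ha

theorem exists_conj_mem_of_not_dvd_index {G : Type*} [Group G] [Finite G] {p : ℕ} [Fact p.Prime]
    (T : Subgroup G) (hT : ¬ p ∣ T.index) {g : G} (hg : g ^ p = 1) :
    ∃ c : G, c⁻¹ * g * c ∈ T := by
  have hp : IsPGroup p (Subgroup.zpowers g) := by
    intro x
    obtain ⟨k, hk⟩ := Subgroup.mem_zpowers_iff.1 x.2
    refine ⟨1, Subtype.ext ?_⟩
    rw [pow_one, Subgroup.coe_pow, ← hk, ← zpow_natCast, ← zpow_mul, mul_comm, zpow_mul,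
      zpow_natCast, hg, one_zpow, Subgroup.coe_one]
  obtain ⟨x, hx⟩ := hp.nonempty_fixed_point_of_prime_not_dvd_card (G ⧸ T) hT
  obtain ⟨c, rfl⟩ := QuotientGroup.mk_surjective x
  refine ⟨c, ?_⟩
  have h := hx ⟨g, Subgroup.mem_zpowers g⟩
  have h' : ((g * c : G) : G ⧸ T) = (c : G ⧸ T) := h
  rw [eq_comm, QuotientGroup.eq] at h'
  simpa [mul_assoc] using h'

theorem Algebra.exists_norm_pi_eq {F K : Type*} [Field F] [Field K] [Finite K] [Algebra F K]
    (u : F) : ∃ y : Fin 3 → K, Algebra.norm F y = u := by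
  have : Finite F := Finite.of_injective _ (algebraMap F K).injective
  have : Module.Finite F K := Module.Finite.of_finite
  obtain ⟨k, hk⟩ := FiniteField.norm_surjective F K u
  refine ⟨![k, 1, 1], ?_⟩
  have : Algebra.lmul F (Fin 3 → K) ![k, 1, 1] =
      LinearMap.pi fun i => (Algebra.lmul F K ((![k, 1, 1] : Fin 3 → K) i)).comp
        (LinearMap.proj i) := by
    ext v i; simp
  rw [Algebra.norm_apply, this, LinearMap.det_pi, Fin.prod_univ_three]
  simp only [← Algebra.norm_apply]
  simp [hk]

theorem isConj_of_leftMulMatrix {F V n : Type*} [Field F] [CommRing V] [Algebra F V] [Fintype n]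
    [DecidableEq n] (b : Module.Basis n F V)
    (hV : ∀ u : F, ∃ y : V, Algebra.norm F y = u) {A B : Matrix.SpecialLinearGroup n F} {x : V}
    (hB : (B : Matrix n n F) = Algebra.leftMulMatrix b x) {C : Matrix n n F} (hC : IsUnit C.det)
    (h : C * A = B * C) : IsConj A B := by
  obtain ⟨y, hy⟩ := hV (C.det)⁻¹
  rw [Algebra.norm_eq_matrix_det b] at hy
  refine isConj_iff.2 ⟨⟨Algebra.leftMulMatrix b y * C, ?_⟩, ?_⟩
  · rw [Matrix.det_mul, hy, inv_mul_cancel₀ hC.ne_zero]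
  · refine mul_inv_eq_iff_eq_mul.2 (Subtype.ext ?_)
    change Algebra.leftMulMatrix b y * C * (A : Matrix n n F) = B * (Algebra.leftMulMatrix b y * C)
    rw [mul_assoc, h, ← mul_assoc, ← mul_assoc, hB, ← map_mul, ← map_mul, mul_comm]

theorem not_dvd_index_of_card {G : Type*} [Group G] (T : Subgroup G) {q r : ℕ} (hr : r.Prime)
    (hr5 : 5 ≤ r) (hq : 2 ≤ q) (hdvd : r ∣ q + 1) (hT : Nat.card T = (q ^ 2 - 1) ^ 3)
    (hG : Nat.card G = ∏ i : Fin 6, (q ^ 6 - q ^ (i : ℕ))) : ¬ r ∣ T.index := by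
  have h := T.card_mul_index
  rw [hT, hG] at h
  have hle : ∀ i : Fin 6, q ^ (i : ℕ) ≤ q ^ 6 := fun i => Nat.pow_le_pow_right (by omega) i.2.le
  have hz : (T.index : ℤ) = q ^ 15 * (q ^ 5 - 1) * (q ^ 3 - 1) * (q - 1) * (q ^ 2 + 1) *
      (q ^ 4 + q ^ 2 + 1) := by
    have h0 : ((q : ℤ) ^ 2 - 1) ^ 3 ≠ 0 := by
      have : (2 : ℤ) ≤ q := by exact_mod_cast hq
      have : 0 < (q : ℤ) ^ 2 - 1 := by nlinarith
      positivity
    apply mul_left_cancel₀ h0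
    have h' := congrArg (Nat.cast : ℕ → ℤ) h
    rw [Nat.cast_prod, Finset.prod_congr rfl fun i _ => Nat.cast_sub (hle i), Nat.cast_mul,
      Nat.cast_pow, Nat.cast_sub (Nat.one_le_pow 2 q (by omega))] at h'
    simp only [Nat.cast_pow, Nat.cast_one] at h'
    rw [h']
    simp [Fin.prod_univ_succ]
    ring
  have : Fact r.Prime := ⟨hr⟩
  intro hd
  have hq1 : (q : ZMod r) = -1 := by
    have := (ZMod.natCast_eq_zero_iff (q + 1) r).2 hdvd
    push_cast at this
    exact eq_neg_of_add_eq_zero_left this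
  have h1 : ((T.index : ℤ) : ZMod r) = 0 := by
    rw [Int.cast_natCast]; exact (ZMod.natCast_eq_zero_iff _ r).2 hd
  rw [hz] at h1
  push_cast at h1
  rw [hq1] at h1
  ring_nf at h1
  have h48 : ((48 : ℕ) : ZMod r) = 0 := by push_cast; exact h1
  rw [ZMod.natCast_eq_zero_iff] at h48
  have : r ∣ 2 ^ 4 * 3 := by simpa using h48
  rcases (hr.dvd_mul).1 this with h | h
  · have := Nat.le_of_dvd (by omega) (hr.dvd_of_dvd_pow h)
    omega
  · have := Nat.le_of_dvd (by omega) h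
    omega

theorem isConj_of_linearEquiv {F V n : Type*} [Field F] [CommRing V] [Algebra F V] [Fintype n]
    [DecidableEq n] (b : Module.Basis n F V)
    (hV : ∀ u : F, ∃ y : V, Algebra.norm F y = u) {A B : Matrix.SpecialLinearGroup n F} {x y : V}
    (hA : (A : Matrix n n F) = Algebra.leftMulMatrix b x)
    (hB : (B : Matrix n n F) = Algebra.leftMulMatrix b y) (w : V ≃ₗ[F] V)
    (h : ∀ v, w (x * v) = y * w v) : IsConj A B := by
  refine isConj_of_leftMulMatrix b hV hB (C := LinearMap.toMatrix b b w) (w.isUnit_det b b) ?_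
  rw [hA, hB, Algebra.leftMulMatrix_apply, Algebra.leftMulMatrix_apply, ← LinearMap.toMatrix_comp,
    ← LinearMap.toMatrix_comp]
  congr 1
  ext v
  simp [h]

theorem card_range_unitsMap_leftMulMatrix {F K : Type*} [Field F] [Field K] [Finite K] [Algebra F K]
    (hK : Module.finrank F K = 2) (b : Module.Basis (Fin 6) F (Fin 3 → K)) :
    Nat.card (Units.map (Algebra.leftMulMatrix b : (Fin 3 → K) →* Matrix (Fin 6) (Fin 6) F)).range =
      (Nat.card F ^ 2 - 1) ^ 3 := by
  have := Fintype.ofFinite K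
  have : Finite F := Finite.of_injective _ (algebraMap F K).injective
  have : Module.Finite F K := Module.Finite.of_finite
  have hinj : Function.Injective
      (Units.map (Algebra.leftMulMatrix b : (Fin 3 → K) →* Matrix (Fin 6) (Fin 6) F)) :=
    Units.map_injective (Algebra.leftMulMatrix_injective b)
  rw [← Nat.card_congr (MonoidHom.ofInjective hinj).toEquiv,
    Nat.card_congr MulEquiv.piUnits.toEquiv, Nat.card_pi, Finset.prod_const, Finset.card_univ,
    Fintype.card_fin, Nat.card_units, Module.natCard_eq_pow_finrank (K := F) (V := K), hK]

theorem FiniteField.eq_one_of_pow_eq_one_s9 {F : Type*} [Field F] [Finite F] {r : ℕ}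
    (hr : r.Prime) (hr5 : 5 ≤ r) (hdvd : r ∣ Nat.card F + 1) {u : F} (hu : u ^ r = 1) : u = 1 := by
  have := Fintype.ofFinite F
  have hu0 : u ≠ 0 := by
    rintro rfl
    simp [hr.ne_zero] at hu
  have h1 := FiniteField.pow_card_sub_one_eq_one u hu0
  rw [← Nat.card_eq_fintype_card] at h1
  have hc : Nat.Coprime r (Nat.card F - 1) := by
    rw [hr.coprime_iff_not_dvd]
    intro h
    have hF := Finite.one_lt_card (α := F)
    have h2 := Nat.dvd_sub hdvd h
    have := Nat.le_of_dvd (by omega) h2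
    omega
  have := pow_gcd_eq_one.2 ⟨hu, h1⟩
  rwa [hc, pow_one] at this

open Pointwise in
/-- The conjugacy class of the cyclic subgroup generated by `x`. -/
noncomputable def zpowersClass {J : Type*} [Group J] (x : J) :
    Quotient (MulAction.orbitRel (ConjAct J) (Subgroup J)) :=
  Quotient.mk (MulAction.orbitRel (ConjAct J) (Subgroup J)) (Subgroup.zpowers x)

open Pointwise in
theorem zpowersClass_eq_of_isConj {J : Type*} [Group J] {x y : J} (h : IsConj x y) :
    zpowersClass x = zpowersClass y := by
  obtain ⟨c, rfl⟩ := isConj_iff.1 h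
  refine (Quotient.sound (s := MulAction.orbitRel (ConjAct J) (Subgroup J)) ?_).symm
  refine ⟨ConjAct.toConjAct c, ?_⟩
  change ConjAct.toConjAct c • Subgroup.zpowers x = _
  exact MonoidHom.map_zpowers (MulDistribMulAction.toMonoidEnd (ConjAct J) J
    (ConjAct.toConjAct c) : J →* J) x

open Pointwise in
theorem kappa_le_card {J : Type*} [Group J] {r : ℕ}
    (S : Finset (Quotient (MulAction.orbitRel (ConjAct J) (Subgroup J))))
    (hr : r.Prime) (h : ∀ x : J, orderOf x = r → zpowersClass x ∈ S) : kappa J r ≤ S.card := by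
  rw [kappa, ← Fintype.card_coe, ← Nat.card_eq_fintype_card]
  refine Nat.card_mono S.finite_toSet ?_
  rintro _ ⟨H, hH, rfl⟩
  have : Fact r.Prime := ⟨hr⟩
  have := isCyclic_of_prime_card hH
  obtain ⟨x, hx⟩ := H.isCyclic_iff_exists_zpowers_eq_top.1 this
  rw [← hx]
  refine h x ?_
  rw [← Nat.card_zpowers, hx, hH]

theorem ZMod.pow_val_eq {M : Type*} [Monoid M] {r : ℕ} [NeZero r] {z : M} (hz : z ^ r = 1)
    {a : ZMod r} {n : ℕ} (h : a = n) : z ^ a.val = z ^ n := by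
  rw [h, ZMod.val_natCast, ← pow_eq_pow_mod n hz]

theorem frobenius_pow_val {K : Type*} [Field K] {r q : ℕ} [NeZero r] (hdvd : r ∣ q + 1) {z : K}
    (hz : z ^ r = 1) (a : ZMod r) : (z ^ a.val) ^ q = z ^ (-a).val := by
  rw [← pow_mul]
  refine (ZMod.pow_val_eq hz ?_).symm
  have := (ZMod.natCast_eq_zero_iff (q + 1) r).2 hdvd
  push_cast at this
  rw [Nat.cast_mul, ZMod.natCast_val, ZMod.cast_id, eq_neg_of_add_eq_zero_left this, mul_neg_one]

open Pointwise in
theorem eight_mul_kappa_le_of_finrank_eq_two {F K : Type*} [Field F] [Field K] [Finite K]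
    [Algebra F K] (hK : Module.finrank F K = 2) {r : ℕ} (hr : r.Prime) (hr5 : 5 ≤ r)
    (hdvd : r ∣ Nat.card F + 1) :
    8 * kappa (Matrix.ProjectiveSpecialLinearGroup (Fin 6) F) r ≤ r ^ 2 + 15 := by
  have : Finite F := Finite.of_injective _ (algebraMap F K).injective
  have := Fintype.ofFinite F
  have := Fintype.ofFinite K
  have : Module.Finite F K := Module.Finite.of_finite
  have : Fact r.Prime := ⟨hr⟩
  have hdvd' : r ∣ Nat.card Kˣ := by
    rw [Nat.card_units, Module.natCard_eq_pow_finrank (K := F) (V := K), hK]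
    have := Nat.sq_sub_sq (Nat.card F) 1
    rw [one_pow] at this
    exact this ▸ hdvd.mul_right _
  obtain ⟨z, hz⟩ : ∃ z : K, IsPrimitiveRoot z r := by
    obtain ⟨z, hz⟩ := exists_prime_orderOf_dvd_card' r hdvd'
    exact ⟨z, IsPrimitiveRoot.coe_units_iff.2 (IsPrimitiveRoot.iff_orderOf.2 hz)⟩
  have hV : Module.finrank F (Fin 3 → K) = 6 := by
    rw [Module.finrank_pi_fintype]; simp [hK]
  let b : Module.Basis (Fin 6) F (Fin 3 → K) := Module.finBasisOfFinrankEq F _ hV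
  have hnorm : ∀ u : F, ∃ y : Fin 3 → K, Algebra.norm F y = u := Algebra.exists_norm_pi_eq
  let X : (Fin 3 → ZMod r) → (Fin 3 → K) := fun e i => z ^ (e i).val
  have hX : ∀ e, X e ^ r = 1 := fun e => funext fun i => by
    simp only [X, Pi.pow_apply, Pi.one_apply]
    rw [pow_right_comm, hz.pow_eq_one, one_pow]
  have hD : ∀ e, ∃ A : Matrix.SpecialLinearGroup (Fin 6) F,
      (A : Matrix (Fin 6) (Fin 6) F) = Algebra.leftMulMatrix b (X e) := fun e => by
    refine ⟨⟨Algebra.leftMulMatrix b (X e), ?_⟩, rfl⟩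
    rw [← Algebra.norm_eq_matrix_det]
    refine FiniteField.eq_one_of_pow_eq_one_s9 hr hr5 hdvd ?_
    rw [← map_pow, hX, map_one]
  choose D hD using hD
  let g : (Fin 3 → ZMod r) → Quotient (MulAction.orbitRel
      (ConjAct (Matrix.ProjectiveSpecialLinearGroup (Fin 6) F))
      (Subgroup (Matrix.ProjectiveSpecialLinearGroup (Fin 6) F))) := fun e =>
    zpowersClass (D e : Matrix.ProjectiveSpecialLinearGroup (Fin 6) F)
  have g_eq : ∀ {A B : Matrix.SpecialLinearGroup (Fin 6) F}, IsConj A B →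
      zpowersClass (A : Matrix.ProjectiveSpecialLinearGroup (Fin 6) F) =
      zpowersClass (B : Matrix.ProjectiveSpecialLinearGroup (Fin 6) F) := fun h =>
    zpowersClass_eq_of_isConj ((QuotientGroup.mk' _).map_isConj h)
  have g_perm : ∀ (e : Fin 3 → ZMod r) (s : Equiv.Perm (Fin 3)), g e = g (e ∘ s) := fun e s =>
    g_eq (isConj_of_linearEquiv b hnorm (hD e) (hD (e ∘ s)) (LinearEquiv.funCongrLeft F K s)
      fun v => by ext i; simp [X, LinearMap.funLeft_apply])
  have g_neg : ∀ a b c, g ![-a, b, c] = g ![a, b, c] := fun a₀ b₀ c₀ =>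
    (g_eq (isConj_of_linearEquiv b hnorm (hD ![a₀, b₀, c₀]) (hD ![-a₀, b₀, c₀])
      (LinearEquiv.piCongrRight fun i => if i = 0 then
        (FiniteField.frobeniusAlgEquivOfAlgebraic F K).toLinearEquiv else LinearEquiv.refl F K)
      fun v => by
        ext i
        fin_cases i
        · simp [X, mul_pow, ← Nat.card_eq_fintype_card, frobenius_pow_val hdvd hz.pow_eq_one]
        · simp [X]
        · simp [X])).symm
  have g_scale_le : ∀ (k : ZMod r) (e : Fin 3 → ZMod r),
      Subgroup.zpowers (D (fun i => k * e i) : Matrix.ProjectiveSpecialLinearGroup (Fin 6) F) ≤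
      Subgroup.zpowers (D e : Matrix.ProjectiveSpecialLinearGroup (Fin 6) F) := fun k e => by
    have : D (fun i => k * e i) = D e ^ k.val := by
      refine Subtype.ext ?_
      change (D (fun i => k * e i) : Matrix (Fin 6) (Fin 6) F) = ↑(D e ^ k.val)
      rw [Matrix.SpecialLinearGroup.coe_pow, hD, hD, ← map_pow]
      congr 1
      ext i
      simp only [X, Pi.pow_apply, ← pow_mul]
      refine ZMod.pow_val_eq hz.pow_eq_one ?_
      simp [mul_comm]
    rw [this, Subgroup.zpowers_le, QuotientGroup.mk_pow]
    exact Subgroup.pow_mem _ (Subgroup.mem_zpowers _) _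
  have g_scale : ∀ (k : ZMod r) (e : Fin 3 → ZMod r), k ≠ 0 → g (fun i => k * e i) = g e := by
    intro k e hk
    have h := g_scale_le k⁻¹ (fun i => k * e i)
    simp only [inv_mul_cancel_left₀ hk] at h
    simp only [g, zpowersClass, le_antisymm (g_scale_le k e) h]
  obtain ⟨S, hS, hgS⟩ := exists_card_le_image_of_symmetric hr hr5 (fun a b c => g ![a, b, c])
    (fun a b c => by
      rw [g_perm _ (Equiv.swap 0 1)]
      congr 1; ext i; fin_cases i <;> rfl)
    (fun a b c => by
      rw [g_perm _ (Equiv.swap 1 2)]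
      congr 1; ext i; fin_cases i <;> rfl)
    g_neg
    (fun k a b c hk => by
      rw [← g_scale k ![a, b, c] hk]
      congr 1; ext i; fin_cases i <;> rfl)
  refine le_trans (Nat.mul_le_mul_left 8 (kappa_le_card S hr fun x hx => ?_)) hS
  obtain ⟨A₀, rfl⟩ := QuotientGroup.mk_surjective x
  set x : Matrix.ProjectiveSpecialLinearGroup (Fin 6) F := QuotientGroup.mk A₀ with hxdef
  have hAr : (A₀ ^ 6) ^ r = 1 := by
    have : A₀ ^ r ∈ Subgroup.center (Matrix.SpecialLinearGroup (Fin 6) F) := by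
      rw [← QuotientGroup.eq_one_iff, QuotientGroup.mk_pow, ← hx, pow_orderOf_eq_one]
    obtain ⟨c, hc, hcA⟩ := Matrix.SpecialLinearGroup.mem_center_iff.1 this
    rw [pow_right_comm]
    refine Subtype.ext ?_
    change ((A₀ ^ r) ^ 6 : Matrix.SpecialLinearGroup (Fin 6) F).1 = 1
    have h6 : ((A₀ ^ r) ^ 6 : Matrix.SpecialLinearGroup (Fin 6) F).1 = (A₀ ^ r).1 ^ 6 :=
      Matrix.SpecialLinearGroup.coe_pow _ _
    rw [h6, ← hcA, ← map_pow]
    rw [Fintype.card_fin] at hc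
    rw [hc, map_one]
  have hxz : Subgroup.zpowers x = Subgroup.zpowers (x ^ 6) := by
    have hcop : Nat.Coprime (orderOf x) 6 := by
      rw [hx, hr.coprime_iff_not_dvd]
      intro h
      have := Nat.le_of_dvd (by omega) h
      interval_cases r <;> revert h hr <;> decide
    refine le_antisymm (Subgroup.zpowers_le.2 ?_)
      (Subgroup.zpowers_le.2 (Subgroup.pow_mem _ (Subgroup.mem_zpowers _) _))
    obtain ⟨m, hm⟩ := exists_pow_eq_self_of_coprime hcop.symm
    have := Subgroup.pow_mem _ (Subgroup.mem_zpowers (x ^ 6)) m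
    rwa [hm] at this
  let A' : Matrix.GeneralLinearGroup (Fin 6) F := Matrix.SpecialLinearGroup.toGL (A₀ ^ 6)
  have hA' : A' ^ r = 1 := by rw [← map_pow, hAr, map_one]
  obtain ⟨c, y, hy⟩ := exists_conj_mem_of_not_dvd_index
    (Units.map (Algebra.leftMulMatrix b : (Fin 3 → K) →* Matrix (Fin 6) (Fin 6) F)).range
    (not_dvd_index_of_card _ hr hr5 Finite.one_lt_card hdvd
      (card_range_unitsMap_leftMulMatrix hK b)
      (by rw [Matrix.card_GL_field, Nat.card_eq_fintype_card])) hA'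
  have hyr : y ^ r = 1 := by
    apply Units.map_injective
      (f := (Algebra.leftMulMatrix b : (Fin 3 → K) →* Matrix (Fin 6) (Fin 6) F))
      (Algebra.leftMulMatrix_injective b)
    rw [map_pow, hy, map_one]
    have := conj_pow (i := r) (a := c⁻¹) (b := A')
    rw [inv_inv, hA'] at this
    rw [this]; group
  have hy' : ∀ i, ∃ k, k < r ∧ z ^ k = (y : Fin 3 → K) i := fun i =>
    hz.eq_pow_of_pow_eq_one (congrFun (congrArg Units.val hyr) i)
  choose k hk hky using hy'
  have hXe : X (fun i => (k i : ZMod r)) = y := by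
    ext i
    simp only [X]
    rw [ZMod.val_natCast, Nat.mod_eq_of_lt (hk i), hky]
  set e : Fin 3 → ZMod r := fun i => (k i : ZMod r) with he
  have hconj : IsConj (A₀ ^ 6) (D e) := by
    refine isConj_of_leftMulMatrix b hnorm (hD e) (C := (c⁻¹).1)
      ((Matrix.isUnit_iff_isUnit_det _).1 (c⁻¹).isUnit) ?_
    rw [hD, hXe]
    have h : c⁻¹ * A' = Units.map (Algebra.leftMulMatrix b :
        (Fin 3 → K) →* Matrix (Fin 6) (Fin 6) F) y * c⁻¹ := by rw [hy]; group
    exact congrArg Units.val h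
  have hge : zpowersClass x = g e := by
    rw [zpowersClass, hxz]
    exact g_eq hconj
  rw [hge]
  have he3 : e = ![e 0, e 1, e 2] := by ext i; fin_cases i <;> rfl
  rw [he3]
  refine hgS _ _ _ ?_
  rintro ⟨h0, h1, h2⟩
  rw [h0, h1, h2] at he3
  have hD1 : D e = 1 := by
    refine Subtype.ext ?_
    refine (hD e).trans ?_
    have : X e = 1 := by
      rw [he3]; ext i; fin_cases i <;> simp [X]
    rw [this, map_one]; rfl
  rw [hD1, isConj_one_left] at hconj
  have hx6 : x ^ 6 = 1 := by rw [hxdef, ← QuotientGroup.mk_pow, hconj]; rfl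
  rw [hx6] at hxz
  have := congrArg (fun H : Subgroup _ => Nat.card H) hxz
  simp only [Nat.card_zpowers, hx, orderOf_one] at this
  omega

/-- Lemma 2.9(iii), linear case: if `r ≥ 5` is a prime dividing `q + 1`, then
`8·κ(PSL_6(q), r) ≤ r² + 15`. -/
theorem stmt_9 {q : ℕ} (r : ℕ) (F : Type*) [Field F] [Fintype F]
    (hq : Fintype.card F = q) (hr : r.Prime) (hr5 : 5 ≤ r) (hdvd : r ∣ q + 1) :
    8 * kappa (Matrix.ProjectiveSpecialLinearGroup (Fin 6) F) r ≤ r ^ 2 + 15 := by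
  obtain ⟨p, hp⟩ := CharP.exists F
  have : Fact p.Prime := ⟨CharP.char_is_prime F p⟩
  rw [← hq, ← Nat.card_eq_fintype_card] at hdvd
  exact eight_mul_kappa_le_of_finrank_eq_two (K := FiniteField.Extension F p 2)
    (FiniteField.finrank_extension F p 2) hr hr5 hdvd
end

section
/- Let F_q be a finite field with q elements, let r be an odd prime not dividing q, and let i be the smallest positive integer such that r divides q^i − 1. Let n1, n2 be integers with 2 ≤ i ≤ n1 and n2 > 2·n1. Then κ(PSL_{n2}(q), r) > κ(PSL_{n1}(q), r). -/
open Pointwise in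
/-- Two subgroups generated by elements of prime order `r` are conjugate as soon as a conjugate of
one generator lies in the subgroup generated by the other. -/
theorem orbitRel_zpowers_iff {J : Type*} [Group J] {r : ℕ} (hr : r.Prime) {x y : J}
    (hx : orderOf x = r) (hy : orderOf y = r) :
    MulAction.orbitRel (ConjAct J) (Subgroup J) (Subgroup.zpowers x) (Subgroup.zpowers y) ↔
      ∃ g : J, g * x * g⁻¹ ∈ Subgroup.zpowers y := by
  have key (g : J) : ConjAct.toConjAct g • Subgroup.zpowers x =
      Subgroup.zpowers (g * x * g⁻¹) :=
    MonoidHom.map_zpowers (MulAut.conj g).toMonoidHom x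
  rw [(MulAction.orbitRel (ConjAct J) (Subgroup J)).comm', MulAction.orbitRel_apply]
  constructor
  · rintro ⟨g, hg⟩
    refine ⟨ConjAct.ofConjAct g, ?_⟩
    have hg' : ConjAct.toConjAct (ConjAct.ofConjAct g) • Subgroup.zpowers x =
        Subgroup.zpowers y := hg
    rw [key] at hg'
    exact hg' ▸ Subgroup.mem_zpowers _
  · rintro ⟨g, hg⟩
    refine ⟨ConjAct.toConjAct g, ?_⟩
    change ConjAct.toConjAct g • Subgroup.zpowers x = _
    rw [key]
    have : Finite (Subgroup.zpowers y) :=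
      Nat.finite_of_card_ne_zero (by rw [Nat.card_zpowers, hy]; exact hr.ne_zero)
    refine Subgroup.eq_of_le_of_card_ge (by rwa [Subgroup.zpowers_le]) ?_
    have hc : orderOf (g * x * g⁻¹) = r := by
      rw [← hx]; exact (MulAut.conj g).orderOf_eq x
    rw [Nat.card_zpowers, Nat.card_zpowers, hc, hy]

open Pointwise in
/-- The conjugacy classes of subgroups of order `r`. -/
abbrev PrimeSubgroupClass (J : Type*) [Group J] (r : ℕ) : Type _ :=
  {c : Quotient (MulAction.orbitRel (ConjAct J) (Subgroup J)) //
    ∃ H : Subgroup J, Nat.card H = r ∧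
      Quotient.mk (MulAction.orbitRel (ConjAct J) (Subgroup J)) H = c}

open Pointwise in
/-- The class of the subgroup generated by an element of order `r`. -/
def PrimeSubgroupClass.ofElement {J : Type*} [Group J] {r : ℕ} (x : J) (hx : orderOf x = r) :
    PrimeSubgroupClass J r :=
  ⟨Quotient.mk _ (Subgroup.zpowers x), Subgroup.zpowers x, by rw [Nat.card_zpowers, hx], rfl⟩

theorem PrimeSubgroupClass.ofElement_eq_iff {J : Type*} [Group J] {r : ℕ} (hr : r.Prime) {x y : J}
    (hx : orderOf x = r) (hy : orderOf y = r) :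
    ofElement x hx = ofElement y hy ↔ ∃ g : J, g * x * g⁻¹ ∈ Subgroup.zpowers y := by
  rw [← orbitRel_zpowers_iff hr hx hy, ofElement, ofElement, Subtype.mk.injEq]
  exact Quotient.eq

theorem PrimeSubgroupClass.exists_ofElement_eq {J : Type*} [Group J] {r : ℕ} (hr : r.Prime)
    (c : PrimeSubgroupClass J r) : ∃ (x : J) (hx : orderOf x = r), ofElement x hx = c := by
  obtain ⟨c, H, hH, rfl⟩ := c
  have := Fact.mk hr
  have : IsCyclic H := isCyclic_of_prime_card hH
  obtain ⟨x, hx⟩ := IsCyclic.exists_generator (α := H)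
  have hz : Subgroup.zpowers (x : J) = H := by
    ext y
    constructor
    · rintro ⟨k, rfl⟩
      exact H.zpow_mem x.2 k
    · intro hy
      obtain ⟨k, hk⟩ := hx ⟨y, hy⟩
      exact ⟨k, by simpa using congrArg Subtype.val hk⟩
  refine ⟨x, by rw [← Nat.card_zpowers, hz, hH], ?_⟩
  simp only [ofElement, hz]

/-- A relation between elements of order `r` that reflects conjugacy of the generated subgroups
induces an injection on classes of subgroups. -/
theorem PrimeSubgroupClass.exists_injective {J₁ J₂ : Type*} [Group J₁] [Group J₂] {r : ℕ}
    (hr : r.Prime) (R : J₁ → J₂ → Prop)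
    (hR : ∀ x, orderOf x = r → ∃ y, orderOf y = r ∧ R x y)
    (h : ∀ x x' y y' g, orderOf x = r → orderOf x' = r → orderOf y = r → orderOf y' = r →
      R x y → R x' y' → g * y * g⁻¹ ∈ Subgroup.zpowers y' →
      ∃ k, k * x * k⁻¹ ∈ Subgroup.zpowers x') :
    ∃ f : PrimeSubgroupClass J₁ r → PrimeSubgroupClass J₂ r, Function.Injective f ∧
      ∀ c, ∃ (x : J₁) (y : J₂) (hy : orderOf y = r), orderOf x = r ∧ R x y ∧
        f c = ofElement y hy := by
  choose s hs hsc using exists_ofElement_eq (J := J₁) hr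
  choose t ht htR using hR
  refine ⟨fun c => ofElement (t (s c) (hs c)) (ht _ _), fun c c' hcc => ?_,
    fun c => ⟨s c, _, ht _ (hs c), hs c, htR _ _, rfl⟩⟩
  obtain ⟨g, hg⟩ := (ofElement_eq_iff hr _ _).1 hcc
  rw [← hsc c, ← hsc c', ofElement_eq_iff hr]
  exact h _ _ _ _ g (hs c) (hs c') (ht _ _) (ht _ _) (htR _ _) (htR _ _) hg

theorem kappa_le_of_rel {J₁ J₂ : Type*} [Group J₁] [Group J₂] [Finite J₂] {r : ℕ}
    (hr : r.Prime) (R : J₁ → J₂ → Prop)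
    (hR : ∀ x, orderOf x = r → ∃ y, orderOf y = r ∧ R x y)
    (h : ∀ x x' y y' g, orderOf x = r → orderOf x' = r → orderOf y = r → orderOf y' = r →
      R x y → R x' y' → g * y * g⁻¹ ∈ Subgroup.zpowers y' →
      ∃ k, k * x * k⁻¹ ∈ Subgroup.zpowers x') :
    kappa J₁ r ≤ kappa J₂ r := by
  obtain ⟨f, hf, -⟩ := PrimeSubgroupClass.exists_injective hr R hR h
  exact Nat.card_le_card_of_injective f hf

theorem kappa_lt_of_rel {J₁ J₂ : Type*} [Group J₁] [Group J₂] [Finite J₂] {r : ℕ}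
    (hr : r.Prime) (R : J₁ → J₂ → Prop)
    (hR : ∀ x, orderOf x = r → ∃ y, orderOf y = r ∧ R x y)
    (h : ∀ x x' y y' g, orderOf x = r → orderOf x' = r → orderOf y = r → orderOf y' = r →
      R x y → R x' y' → g * y * g⁻¹ ∈ Subgroup.zpowers y' →
      ∃ k, k * x * k⁻¹ ∈ Subgroup.zpowers x')
    (z : J₂) (hz : orderOf z = r)
    (hzR : ∀ x y g, orderOf x = r → orderOf y = r → R x y →
      g * z * g⁻¹ ∉ Subgroup.zpowers y) :
    kappa J₁ r < kappa J₂ r := by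
  obtain ⟨f, hf, hfR⟩ := PrimeSubgroupClass.exists_injective hr R hR h
  refine lt_of_le_of_ne (Nat.card_le_card_of_injective f hf) fun hcard :
    Nat.card (PrimeSubgroupClass J₁ r) = Nat.card (PrimeSubgroupClass J₂ r) => ?_
  have hsurj := ((Nat.bijective_iff_injective_and_card f).2 ⟨hf, hcard⟩).surjective
    (.ofElement z hz)
  obtain ⟨c, hc⟩ := hsurj
  obtain ⟨x, y, hy, hx, hxy, hc'⟩ := hfR c
  obtain ⟨g, hg⟩ := (PrimeSubgroupClass.ofElement_eq_iff hr hz hy).1 (hc.symm.trans hc')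
  exact hzR x y g hx hy hxy hg

/-- Dividing out a central subgroup whose exponent is prime to `r` does not change the number of
classes of subgroups of order `r`. -/
theorem kappa_quotient_eq {G : Type*} [Group G] [Finite G] (Z : Subgroup G) [Z.Normal]
    (hZ : Z ≤ Subgroup.center G) {r N : ℕ} (hr : r.Prime) (hN : N.Coprime r)
    (hZN : ∀ z ∈ Z, z ^ N = 1) : kappa (G ⧸ Z) r = kappa G r := by
  have htriv : ∀ z ∈ Z, z ^ r = 1 → z = 1 := fun z hz hzr => by
    rw [← orderOf_eq_one_iff]
    exact Nat.eq_one_of_dvd_coprimes hN (orderOf_dvd_of_pow_eq_one (hZN z hz))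
      (orderOf_dvd_of_pow_eq_one hzr)
  have := Fact.mk hr
  have hord (x : G) (hx : orderOf x = r) : orderOf (x : G ⧸ Z) = r := by
    refine orderOf_eq_prime ?_ fun h1 => ?_
    · rw [← QuotientGroup.mk_pow, ← hx, pow_orderOf_eq_one, QuotientGroup.mk_one]
    · rw [QuotientGroup.eq_one_iff] at h1
      have := htriv x h1 (by rw [← hx, pow_orderOf_eq_one])
      rw [this, orderOf_one] at hx
      exact hr.one_lt.ne hx
  apply le_antisymm
  · refine kappa_le_of_rel hr (fun x y => (y : G ⧸ Z) = x) (fun x hx => ?_) ?_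
    · obtain ⟨g, rfl⟩ := QuotientGroup.mk_surjective x
      obtain ⟨m, -, hm⟩ := Nat.exists_mul_mod_eq_one_of_coprime hN hr.one_lt
      have hmk : ((g ^ (N * m) : G) : G ⧸ Z) = g := by
        rw [QuotientGroup.mk_pow, ← pow_mod_orderOf, hx, hm, pow_one]
      refine ⟨g ^ (N * m), orderOf_eq_prime ?_ fun h1 => ?_, hmk⟩
      · have hg : g ^ r ∈ Z := by
          rw [← QuotientGroup.eq_one_iff, QuotientGroup.mk_pow, ← hx, pow_orderOf_eq_one]
        rw [← pow_mul, mul_comm, pow_mul, pow_mul, hZN _ hg, one_pow]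
      · rw [h1] at hmk
        rw [← hmk, QuotientGroup.mk_one, orderOf_one] at hx
        exact hr.one_lt.ne hx
    · rintro _ _ y y' g - - - - rfl rfl ⟨k, hk⟩
      exact ⟨g, k, by simpa using congrArg (QuotientGroup.mk (s := Z)) hk⟩
  · refine kappa_le_of_rel hr (fun x y => (x : G ⧸ Z) = y) (fun x hx => ⟨x, hord x hx, rfl⟩) ?_
    rintro x x' _ _ g hx hx' - - rfl rfl ⟨k, hk⟩
    obtain ⟨g, rfl⟩ := QuotientGroup.mk_surjective g
    refine ⟨g, k, ?_⟩
    have hmem : (x' ^ k)⁻¹ * (g * x * g⁻¹) ∈ Z := by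
      rw [← QuotientGroup.eq]
      simpa using hk
    have hcent := Subgroup.mem_center_iff.1 (hZ hmem) (x' ^ k)
    have h1 : (x' ^ k)⁻¹ * (g * x * g⁻¹) = 1 := by
      refine htriv _ hmem ?_
      have hcomm : Commute (x' ^ k)⁻¹ (g * x * g⁻¹) := by
        rw [Commute.inv_left_iff]
        have h2 : x' ^ k * ((x' ^ k)⁻¹ * (g * x * g⁻¹)) = g * x * g⁻¹ := mul_inv_cancel_left _ _
        rw [hcent] at h2
        calc x' ^ k * (g * x * g⁻¹) = x' ^ k * ((x' ^ k)⁻¹ * (g * x * g⁻¹) * x' ^ k) := by rw [h2]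
          _ = g * x * g⁻¹ * x' ^ k := by group
      rw [hcomm.mul_pow, conj_pow, ← hx, pow_orderOf_eq_one, mul_one, mul_inv_cancel, mul_one,
        inv_pow, inv_eq_one, hx, ← hx', ← zpow_natCast, ← zpow_mul, mul_comm, zpow_mul,
        zpow_natCast, pow_orderOf_eq_one, one_zpow]
    exact inv_mul_eq_one.1 h1

/-- In a finite-dimensional space over a finite field, the determinant maps the centralizer of a
semisimple endomorphism onto the whole multiplicative group. -/
theorem Module.End.IsSemisimple.exists_commute_det_eq {F V : Type*} [Field F] [Finite F]
    [AddCommGroup V] [Module F V] [FiniteDimensional F V] [Nontrivial V] {x : Module.End F V}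
    (hx : x.IsSemisimple) (d : F) : ∃ c : Module.End F V, Commute c x ∧ LinearMap.det c = d := by
  open Polynomial in
  have : IsSemisimpleModule F[X] (AEval' x) := hx
  have : Nontrivial (AEval' x) := (AEval'.of x).symm.toEquiv.nontrivial
  obtain ⟨S, hS⟩ := IsSemisimpleModule.exists_simple_submodule F[X] (AEval' x)
  obtain ⟨S', hSS'⟩ := exists_isCompl S
  obtain ⟨I, hI, ⟨e⟩⟩ := isSimpleModule_iff_quot_maximal.1 hS
  let : Field (F[X] ⧸ I) := Ideal.Quotient.field I
  have : Module.Finite F S := Module.Finite.of_injective (S.subtype.restrictScalars F)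
    S.injective_subtype
  have : Module.Finite F S' := Module.Finite.of_injective (S'.subtype.restrictScalars F)
    S'.injective_subtype
  have : Module.Finite F (F[X] ⧸ I) := Module.Finite.equiv (e.restrictScalars F)
  have : Finite (F[X] ⧸ I) := Module.finite_of_finite F
  obtain ⟨α, rfl⟩ := FiniteField.norm_surjective F (F[X] ⧸ I) d
  let m : (F[X] ⧸ I) →ₗ[F[X]] (F[X] ⧸ I) := LinearMap.mulLeft F[X] α
  let E := Submodule.prodEquivOfIsCompl S S' hSS'
  let cS : S →ₗ[F[X]] S := e.symm.toLinearMap ∘ₗ m ∘ₗ e.toLinearMap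
  let c : AEval' x →ₗ[F[X]] AEval' x :=
    E.toLinearMap ∘ₗ (cS.prodMap LinearMap.id) ∘ₗ E.symm.toLinearMap
  let o := AEval'.of x
  refine ⟨o.symm.toLinearMap ∘ₗ c.restrictScalars F ∘ₗ o.toLinearMap, ?_, ?_⟩
  · ext v
    apply o.injective
    calc c (o (x v)) = (X : F[X]) • c (o v) := by rw [← AEval'.X_smul_of, map_smul]
      _ = o (x (o.symm (c (o v)))) := by rw [← AEval'.X_smul_of, LinearEquiv.apply_symm_apply]
  · have h1 := LinearMap.det_conj (c.restrictScalars F) o.symm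
    have h2 := LinearMap.det_conj ((cS.restrictScalars F).prodMap LinearMap.id)
      (E.restrictScalars F)
    have h3 := LinearMap.det_conj (m.restrictScalars F) (e.symm.restrictScalars F)
    refine h1.trans (h2.trans ?_)
    rw [LinearMap.det_prodMap, LinearMap.det_id, mul_one]
    refine h3.trans ?_
    rw [Algebra.norm_apply]
    rfl

theorem Module.End.isSemisimple_of_pow_eq_one {F V : Type*} [Field F] [AddCommGroup V]
    [Module F V] {x : Module.End F V} {r : ℕ} (hr : (r : F) ≠ 0) (hx : x ^ r = 1) :
    x.IsSemisimple :=
  isSemisimple_of_squarefree_aeval_eq_zero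
    (Polynomial.X_pow_sub_one_separable_iff.2 hr).squarefree (by simp [hx])

theorem Module.End.isCompl_ker_range_sub_one {F V : Type*} [Field F] [AddCommGroup V]
    [Module F V] [FiniteDimensional F V] {x : Module.End F V} {r : ℕ} (hr : (r : F) ≠ 0)
    (hx : x ^ r = 1) : IsCompl (LinearMap.ker (x - 1)) (LinearMap.range (x - 1)) := by
  have hd : Disjoint (LinearMap.ker (x - 1)) (LinearMap.range (x - 1)) := by
    rw [Submodule.disjoint_def]
    rintro _ hv ⟨w, rfl⟩
    set v := (x - 1) w with hvw
    have hxv : x v = v := by simpa [sub_eq_zero] using hv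
    have hpow (j : ℕ) : (x ^ j) v = v := by
      induction j with
      | zero => simp
      | succ j ih => rw [pow_succ, Module.End.mul_apply, hxv, ih]
    have h0 : (∑ j ∈ Finset.range r, x ^ j) v = 0 := by
      rw [hvw, ← Module.End.mul_apply, geom_sum_mul, hx, sub_self, LinearMap.zero_apply]
    rw [LinearMap.sum_apply, Finset.sum_congr rfl fun j _ => hpow j, Finset.sum_const,
      Finset.card_range, ← Nat.cast_smul_eq_nsmul F] at h0
    exact (smul_eq_zero.1 h0).resolve_left hr
  refine ⟨hd, codisjoint_iff.2 (Submodule.eq_top_of_disjoint _ _ ?_ hd)⟩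
  rw [add_comm]
  exact (LinearMap.finrank_range_add_finrank_ker _).ge

/-- An isomorphism between two endomorphisms extended by the identity on a common summand
restricts to an intertwining map that is injective on the non-fixed part. -/
theorem Module.End.exists_intertwining_of_prodMap_id {F V W : Type*} [Field F]
    [AddCommGroup V] [Module F V] [AddCommGroup W] [Module F W] {x y : Module.End F V}
    (e : (V × W) ≃ₗ[F] (V × W))
    (he : ∀ v, e (x.prodMap LinearMap.id v) = y.prodMap LinearMap.id (e v)) :
    ∃ f : Module.End F V, (∀ v, f ((x - 1) v) = (y - 1) (f v)) ∧
      ∀ v ∈ LinearMap.range (x - 1), f v = 0 → v = 0 := by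
  let f : Module.End F V := LinearMap.fst F V W ∘ₗ e.toLinearMap ∘ₗ LinearMap.inl F V W
  have hf (v : V) : e ((x - 1) v, 0) = ((y - 1) (f v), 0) := by
    have h1 : ((x - 1) v, (0 : W)) = x.prodMap LinearMap.id (v, (0 : W)) - (v, 0) := by simp
    rw [h1, map_sub, he]
    exact Prod.ext (by simp [f]) (by simp)
  have hf' (v : V) : f ((x - 1) v) = (y - 1) (f v) := congrArg Prod.fst (hf v)
  refine ⟨f, hf', ?_⟩
  rintro _ ⟨v, rfl⟩ hv
  have h0 := hf v
  rw [← hf', hv, ← Prod.zero_eq_mk, LinearEquiv.map_eq_zero_iff] at h0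
  exact congrArg Prod.fst h0

theorem Module.End.exists_intertwining_equiv_of_prodMap_id {F V W : Type*} [Field F]
    [AddCommGroup V] [Module F V] [AddCommGroup W] [Module F W] [FiniteDimensional F V]
    {x y : Module.End F V} {r : ℕ} (hr : (r : F) ≠ 0) (hx : x ^ r = 1) (hy : y ^ r = 1)
    (e : (V × W) ≃ₗ[F] (V × W))
    (he : ∀ v, e (x.prodMap LinearMap.id v) = y.prodMap LinearMap.id (e v)) :
    ∃ g : V ≃ₗ[F] V, ∀ v, g (x v) = y (g v) := by
  have key {x y : Module.End F V} {f : Module.End F V}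
      (hf : ∀ v, f ((x - 1) v) = (y - 1) (f v))
      (hinj : ∀ v ∈ LinearMap.range (x - 1), f v = 0 → v = 0) :
      ∃ φ : LinearMap.range (x - 1) →ₗ[F] LinearMap.range (y - 1), Function.Injective φ ∧
        ∀ v, (φ v : V) = f v := by
    refine ⟨f.restrict ?_, ?_, fun v => rfl⟩
    · rintro _ ⟨v, rfl⟩
      exact ⟨f v, (hf v).symm⟩
    · rw [← LinearMap.ker_eq_bot, LinearMap.ker_eq_bot']
      intro v hv
      exact Subtype.ext (hinj v v.2 (congrArg Subtype.val hv))
  obtain ⟨f, hf, hfi⟩ := exists_intertwining_of_prodMap_id e he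
  obtain ⟨f', hf', hfi'⟩ := exists_intertwining_of_prodMap_id e.symm fun v => by
    rw [LinearEquiv.symm_apply_eq, he, LinearEquiv.apply_symm_apply]
  obtain ⟨φ, hφ, hφf⟩ := key hf hfi
  obtain ⟨φ', hφ', -⟩ := key hf' hfi'
  have hrange := le_antisymm (LinearMap.finrank_le_finrank_of_injective hφ)
    (LinearMap.finrank_le_finrank_of_injective hφ')
  have hker : Module.finrank F (LinearMap.ker (x - 1)) =
      Module.finrank F (LinearMap.ker (y - 1)) := by
    have h1 := LinearMap.finrank_range_add_finrank_ker (x - 1)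
    have h2 := LinearMap.finrank_range_add_finrank_ker (y - 1)
    omega
  let k := LinearEquiv.ofFinrankEq _ _ hker
  let ψ := LinearMap.linearEquivOfInjective φ hφ hrange
  let P := Submodule.prodEquivOfIsCompl _ _ (isCompl_ker_range_sub_one hr hx)
  let Q := Submodule.prodEquivOfIsCompl _ _ (isCompl_ker_range_sub_one hr hy)
  let g : V ≃ₗ[F] V := P.symm ≪≫ₗ (k.prodCongr ψ) ≪≫ₗ Q
  have hg (a : LinearMap.ker (x - 1)) (b : LinearMap.range (x - 1)) :
      g ((a : V) + (b : V)) = (k a : V) + f b := by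
    have : P.symm ((a : V) + (b : V)) = (a, b) := by
      rw [LinearEquiv.symm_apply_eq]
      simp [P]
    rw [← hφf]
    simp only [g, LinearEquiv.trans_apply, this]
    simp [Q, ψ]
  have hg' (v : V) : g ((x - 1) v) = (y - 1) (g v) := by
    obtain ⟨⟨a, b⟩, rfl⟩ := P.surjective v
    have hP : P (a, b) = (a : V) + (b : V) := by simp [P]
    have ha : (x - 1) (a : V) = 0 := a.2
    have hka : (y - 1) (k a : V) = 0 := (k a).2
    have h1 := hg 0 ⟨(x - 1) b, b, rfl⟩
    rw [map_zero, ZeroMemClass.coe_zero, ZeroMemClass.coe_zero, zero_add, zero_add] at h1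
    rw [hP, hg, map_add, ha, zero_add, map_add (y - 1), hka, zero_add, h1, hf]
  refine ⟨g, fun v => ?_⟩
  simpa using hg' v

/-- Cancellation of a trivial summand for endomorphisms of finite order prime to the
characteristic, with a conjugating map of determinant one. -/
theorem Module.End.exists_det_eq_one_of_prodMap_id {F V W : Type*} [Field F] [Finite F]
    [AddCommGroup V] [Module F V] [AddCommGroup W] [Module F W] [FiniteDimensional F V]
    [Nontrivial V] {x y : Module.End F V} {r : ℕ} (hr : (r : F) ≠ 0) (hx : x ^ r = 1)
    (hy : y ^ r = 1) (e : (V × W) ≃ₗ[F] (V × W))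
    (he : ∀ v, e (x.prodMap LinearMap.id v) = y.prodMap LinearMap.id (e v)) :
    ∃ g : Module.End F V, LinearMap.det g = 1 ∧ g * x = y * g := by
  obtain ⟨g, hg⟩ := exists_intertwining_equiv_of_prodMap_id hr hx hy e he
  obtain ⟨c, hc, hdet⟩ := (isSemisimple_of_pow_eq_one hr hx).exists_commute_det_eq
    (LinearMap.det g.toLinearMap)⁻¹
  have hg' : g.toLinearMap * x = y * g.toLinearMap := LinearMap.ext hg
  refine ⟨g.toLinearMap * c, ?_, ?_⟩
  · rw [map_mul, hdet, mul_inv_cancel₀ g.isUnit_det'.ne_zero]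
  · rw [mul_assoc, hc.eq, ← mul_assoc, hg', mul_assoc]

theorem LinearMap.prodMap_id_pow {R M N : Type*} [Semiring R] [AddCommMonoid M] [AddCommMonoid N]
    [Module R M] [Module R N] (f : Module.End R M) (j : ℕ) :
    (f.prodMap (LinearMap.id : N →ₗ[R] N) : Module.End R (M × N)) ^ j =
      (f ^ j).prodMap LinearMap.id := by
  induction j with
  | zero => rfl
  | succ j ih => rw [pow_succ, ih, pow_succ]; rfl

theorem eq_one_of_pow_eq_one_of_coprime {M : Type*} [Monoid M] {a : M} {m n : ℕ}
    (h : m.Coprime n) (hm : a ^ m = 1) (hn : a ^ n = 1) : a = 1 :=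
  orderOf_eq_one_iff.1 <| Nat.eq_one_of_dvd_coprimes h (orderOf_dvd_of_pow_eq_one hm)
    (orderOf_dvd_of_pow_eq_one hn)

/-- An endomorphism of prime order `r` over a finite field without elements of order `r` is
represented by a matrix of determinant one. -/
theorem Matrix.SpecialLinearGroup.exists_eq_toMatrixAlgEquiv {F V : Type*} [Field F] [Fintype F]
    [AddCommGroup V] [Module F V] {n r : ℕ} (b : Module.Basis (Fin n) F V) (hr : r.Prime)
    (hco : (Fintype.card F - 1).Coprime r) {f : Module.End F V} (hf : f ^ r = 1) (hf1 : f ≠ 1) :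
    ∃ y : Matrix.SpecialLinearGroup (Fin n) F, orderOf y = r ∧
      (y : Matrix (Fin n) (Fin n) F) = LinearMap.toMatrixAlgEquiv b f := by
  have hdet : (LinearMap.toMatrixAlgEquiv b f).det = 1 := by
    have hpow : (LinearMap.toMatrixAlgEquiv b f).det ^ r = 1 := by
      rw [← Matrix.det_pow, ← map_pow, hf, map_one, Matrix.det_one]
    refine eq_one_of_pow_eq_one_of_coprime hco (FiniteField.pow_card_sub_one_eq_one _ ?_) hpow
    rintro h0
    rw [h0, zero_pow hr.ne_zero] at hpow
    exact zero_ne_one hpow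
  have := Fact.mk hr
  refine ⟨⟨_, hdet⟩, orderOf_eq_prime ?_ fun h => hf1 ?_, rfl⟩
  · apply Subtype.ext
    change LinearMap.toMatrixAlgEquiv b f ^ r = 1
    rw [← map_pow, hf, map_one]
  · have h' : LinearMap.toMatrixAlgEquiv b f = 1 := congrArg Subtype.val h
    rwa [EmbeddingLike.map_eq_one_iff] at h'

/-- Matrices conjugate in the special linear group represent isomorphic endomorphisms. -/
theorem Matrix.SpecialLinearGroup.exists_equiv_of_mul_eq_mul {F V V' : Type*} [Field F]
    [AddCommGroup V] [Module F V] [AddCommGroup V'] [Module F V'] {n : ℕ}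
    (b : Module.Basis (Fin n) F V) (b' : Module.Basis (Fin n) F V') {f : Module.End F V}
    {f' : Module.End F V'} (g : Matrix.SpecialLinearGroup (Fin n) F)
    (hg : (g : Matrix (Fin n) (Fin n) F) * LinearMap.toMatrixAlgEquiv b f =
      LinearMap.toMatrixAlgEquiv b' f' * g) :
    ∃ e : V ≃ₗ[F] V', ∀ v, e (f v) = f' (e v) := by
  refine ⟨b.equivFun ≪≫ₗ Matrix.SpecialLinearGroup.toLin' g ≪≫ₗ b'.equivFun.symm, fun v => ?_⟩
  apply b'.equivFun.injective
  have h1 (v : V) : b.equivFun (f v) = (LinearMap.toMatrixAlgEquiv b f).mulVec (b.equivFun v) :=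
    (LinearMap.toMatrix_mulVec_repr b b f v).symm
  have h2 (v : V') : b'.equivFun (f' v) = (LinearMap.toMatrixAlgEquiv b' f').mulVec (b'.equivFun v) :=
    (LinearMap.toMatrix_mulVec_repr b' b' f' v).symm
  rw [h2]
  simp only [LinearEquiv.trans_apply, LinearEquiv.apply_symm_apply, h1,
    Matrix.SpecialLinearGroup.toLin'_apply, Matrix.toLin'_apply, Matrix.mulVec_mulVec, hg]

/-- Extending matrices by an identity block reflects conjugacy of cyclic subgroups of order `r`. -/
theorem Matrix.SpecialLinearGroup.exists_conj_mem_zpowers {F W : Type*} [Field F] [Finite F]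
    [AddCommGroup W] [Module F W] {n n' r : ℕ} [NeZero n] (hr : r.Prime) (hrF : (r : F) ≠ 0)
    (b : Module.Basis (Fin n') F ((Fin n → F) × W))
    {x x' : Matrix.SpecialLinearGroup (Fin n) F} {y y' g : Matrix.SpecialLinearGroup (Fin n') F}
    (hx : x ^ r = 1) (hx' : x' ^ r = 1) (hy' : orderOf y' = r)
    (hxy : (y : Matrix (Fin n') (Fin n') F) =
      LinearMap.toMatrixAlgEquiv b ((Matrix.toLinAlgEquiv' x.1).prodMap LinearMap.id))
    (hxy' : (y' : Matrix (Fin n') (Fin n') F) =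
      LinearMap.toMatrixAlgEquiv b ((Matrix.toLinAlgEquiv' x'.1).prodMap LinearMap.id))
    (hg : g * y * g⁻¹ ∈ Subgroup.zpowers y') : ∃ k, k * x * k⁻¹ ∈ Subgroup.zpowers x' := by
  have hfin : IsOfFinOrder y' := orderOf_pos_iff.1 (hy' ▸ hr.pos)
  obtain ⟨j, hj⟩ := hfin.mem_powers_iff_mem_zpowers.2 hg
  have hj' : y' ^ j = g * y * g⁻¹ := hj
  have hpow : ((y' ^ j : Matrix.SpecialLinearGroup (Fin n') F) : Matrix (Fin n') (Fin n') F) =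
      LinearMap.toMatrixAlgEquiv b
        ((Matrix.toLinAlgEquiv' (x' ^ j).1).prodMap LinearMap.id) := by
    rw [coe_pow, coe_pow, hxy', ← map_pow, map_pow Matrix.toLinAlgEquiv',
      LinearMap.prodMap_id_pow]
  have hmul : (g : Matrix (Fin n') (Fin n') F) * y =
      (y' ^ j : Matrix.SpecialLinearGroup (Fin n') F) * (g : Matrix (Fin n') (Fin n') F) := by
    rw [← coe_mul, ← coe_mul, hj', inv_mul_cancel_right]
  rw [hpow, hxy] at hmul
  obtain ⟨e, he⟩ := exists_equiv_of_mul_eq_mul b b g hmul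
  have hone (w : Matrix.SpecialLinearGroup (Fin n) F) (hw : w ^ r = 1) :
      (Matrix.toLinAlgEquiv' w.1 : Module.End F (Fin n → F)) ^ r = 1 := by
    rw [← map_pow, ← coe_pow, hw, coe_one, map_one]
  obtain ⟨h, hdet, hh⟩ := Module.End.exists_det_eq_one_of_prodMap_id hrF (hone x hx)
    (hone (x' ^ j) (by rw [← pow_mul, mul_comm, pow_mul, hx', one_pow])) e he
  let k : Matrix.SpecialLinearGroup (Fin n) F :=
    ⟨LinearMap.toMatrixAlgEquiv' h, by rw [← hdet]; exact LinearMap.det_toMatrix' h⟩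
  refine ⟨k, j, ?_⟩
  have hk : k * x = x' ^ j * k := by
    apply Subtype.ext
    have := congrArg LinearMap.toMatrixAlgEquiv' hh
    rw [map_mul, map_mul, LinearMap.toMatrixAlgEquiv'_toLinAlgEquiv',
      LinearMap.toMatrixAlgEquiv'_toLinAlgEquiv'] at this
    exact this
  change x' ^ (j : ℤ) = _
  rw [hk, mul_inv_cancel_right, zpow_natCast]

theorem Matrix.SpecialLinearGroup.kappa_lt {F : Type*} [Field F] [Fintype F] {r i n₁ n₂ : ℕ}
    (hr : r.Prime) (hrF : (r : F) ≠ 0) (hco : (Fintype.card F - 1).Coprime r)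
    (hi : 0 < i) (hri : r ∣ Fintype.card F ^ i - 1) (hin : i ≤ n₁) (hn : 2 * n₁ < n₂) :
    kappa (Matrix.SpecialLinearGroup (Fin n₁) F) r <
      kappa (Matrix.SpecialLinearGroup (Fin n₂) F) r := by
  have := Fact.mk hr
  have : NeZero n₁ := ⟨by omega⟩
  have : NeZero i := ⟨hi.ne'⟩
  obtain ⟨p, hp⟩ := CharP.exists F
  have : Fact p.Prime := ⟨CharP.char_is_prime F p⟩
  let K := FiniteField.Extension F p i
  have hK : Module.finrank F K = i := FiniteField.finrank_extension F p i
  obtain ⟨ζ, hζ⟩ : ∃ ζ : Kˣ, orderOf ζ = r := exists_prime_orderOf_dvd_card' r (by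
    rw [Nat.card_units, FiniteField.natCard_extension F p i, Nat.card_eq_fintype_card]
    exact hri)
  have hζ1 : (ζ : K) ≠ 1 := fun h => by
    rw [Units.val_eq_one.1 h, orderOf_one] at hζ
    exact hr.one_lt.ne hζ
  have hζr : (ζ : K) ^ r = 1 := by
    rw [← Units.val_pow_eq_pow_val, ← hζ, pow_orderOf_eq_one, Units.val_one]
  have hdiv : 0 < n₂ / i := Nat.div_pos (by omega) hi
  let b : Module.Basis (Fin n₂) F ((Fin n₁ → F) × (Fin (n₂ - n₁) → F)) :=
    Module.finBasisOfFinrankEq F _ (by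
      rw [Module.finrank_prod, Module.finrank_fin_fun, Module.finrank_fin_fun]; omega)
  let U := (Fin (n₂ / i) → K) × (Fin (n₂ % i) → F)
  let b' : Module.Basis (Fin n₂) F U :=
    Module.finBasisOfFinrankEq F _ (by
      rw [Module.finrank_prod, Module.finrank_fin_fun, Module.finrank_pi_fintype]
      simp only [hK, Finset.sum_const, Finset.card_univ, Fintype.card_fin, smul_eq_mul]
      exact Nat.div_add_mod' n₂ i)
  let f : Module.End F U :=
    (Algebra.lsmul F F (Fin (n₂ / i) → K) (ζ : K)).prodMap LinearMap.id
  have hfix (u : U) (hu : f u = u) : u.1 = 0 := by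
    have h1 : (ζ : K) • u.1 = u.1 := congrArg Prod.fst hu
    have h2 : ((ζ : K) - 1) • u.1 = 0 := by rw [sub_smul, h1, one_smul, sub_self]
    exact (smul_eq_zero.1 h2).resolve_left (sub_ne_zero.2 hζ1)
  obtain ⟨z, hz, hzf⟩ := exists_eq_toMatrixAlgEquiv b' hr hco (f := f) (by
      rw [LinearMap.prodMap_id_pow, ← map_pow, hζr, map_one]
      rfl) (fun h => by
      have := hfix (fun _ => 1, 0) (by rw [h]; rfl)
      exact one_ne_zero (congrFun this ⟨0, hdiv⟩))
  refine kappa_lt_of_rel hr (fun x y => (y : Matrix (Fin n₂) (Fin n₂) F) =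
    LinearMap.toMatrixAlgEquiv b ((Matrix.toLinAlgEquiv' x.1).prodMap LinearMap.id))
    (fun x hx => ?_) (fun x x' y y' g hx hx' _ hy' hxy hxy' hg =>
      exists_conj_mem_zpowers hr hrF b (hx ▸ pow_orderOf_eq_one x) (hx' ▸ pow_orderOf_eq_one x')
        hy' hxy hxy' hg) z hz ?_
  · apply exists_eq_toMatrixAlgEquiv b hr hco
    · rw [LinearMap.prodMap_id_pow, ← map_pow, ← coe_pow, ← hx, pow_orderOf_eq_one, coe_one,
        map_one]
      rfl
    · intro h
      have h1 : Matrix.toLinAlgEquiv' x.1 = 1 :=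
        LinearMap.ext fun v => congrArg Prod.fst (LinearMap.congr_fun h (v, 0))
      rw [EmbeddingLike.map_eq_one_iff] at h1
      have h2 : x = 1 := Subtype.ext h1
      rw [h2, orderOf_one] at hx
      exact hr.one_lt.ne hx
  · intro x y g hx hy hxy hg
    obtain ⟨j, hj⟩ := (orderOf_pos_iff.1 (hy ▸ hr.pos)).mem_powers_iff_mem_zpowers.2 hg
    have hj' : y ^ j = g * z * g⁻¹ := hj
    have hmul : (g⁻¹ : Matrix.SpecialLinearGroup (Fin n₂) F).1 * (y ^ j).1 =
        z.1 * (g⁻¹ : Matrix.SpecialLinearGroup (Fin n₂) F).1 := by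
      rw [← coe_mul, ← coe_mul, hj', mul_assoc g, inv_mul_cancel_left]
    rw [hzf, coe_pow, hxy, ← map_pow] at hmul
    obtain ⟨e, he⟩ := exists_equiv_of_mul_eq_mul b b' g⁻¹ hmul
    let T : (Fin (n₂ - n₁) → F) →ₗ[F] (Fin (n₂ % i) → F) :=
      LinearMap.snd F _ _ ∘ₗ e.toLinearMap ∘ₗ LinearMap.inr F _ _
    have hT : Function.Injective T := by
      rw [← LinearMap.ker_eq_bot, LinearMap.ker_eq_bot']
      intro w hw
      have hfixed := he (0, w)
      rw [LinearMap.prodMap_id_pow, LinearMap.prodMap_apply, map_zero, LinearMap.id_apply] at hfixed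
      have h0 : e (0, w) = 0 := Prod.ext (hfix _ hfixed.symm) hw
      exact congrArg Prod.snd ((LinearEquiv.map_eq_zero_iff e).1 h0)
    have hle := LinearMap.finrank_le_finrank_of_injective hT
    rw [Module.finrank_fin_fun, Module.finrank_fin_fun] at hle
    have := Nat.mod_lt n₂ hi
    omega

theorem Matrix.kappa_projectiveSpecialLinearGroup {F : Type*} [Field F] [Fintype F] {n r : ℕ}
    [NeZero n] (hr : r.Prime) (hco : (Fintype.card F - 1).Coprime r) :
    kappa (Matrix.ProjectiveSpecialLinearGroup (Fin n) F) r =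
      kappa (Matrix.SpecialLinearGroup (Fin n) F) r := by
  refine kappa_quotient_eq _ le_rfl hr hco fun z hz => ?_
  obtain ⟨c, hc, hcz⟩ := Matrix.SpecialLinearGroup.mem_center_iff.1 hz
  have hc0 : c ≠ 0 := by
    rintro rfl
    rw [Fintype.card_fin, zero_pow (NeZero.ne n)] at hc
    exact zero_ne_one hc
  apply Subtype.ext
  rw [Matrix.SpecialLinearGroup.coe_pow, ← hcz, ← map_pow,
    FiniteField.pow_card_sub_one_eq_one c hc0, map_one, Matrix.SpecialLinearGroup.coe_one]

/-- Lemma 2.7, linear case: for an odd prime `r` not dividing `q`, with `i` the smallest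
positive integer such that `r ∣ q^i - 1`, if `2 ≤ i ≤ n₁` and `n₂ > 2n₁` then
`κ(PSL_{n₂}(q), r) > κ(PSL_{n₁}(q), r)`. -/
theorem stmt_10 {q i : ℕ} (r : ℕ) (F : Type*) [Field F] [Fintype F]
    (hq : Fintype.card F = q) (hr : r.Prime) (hodd : Odd r) (hrq : ¬ r ∣ q)
    (hi : 0 < i ∧ r ∣ q ^ i - 1 ∧ ∀ j, 0 < j → r ∣ q ^ j - 1 → i ≤ j)
    (n1 n2 : ℕ) (hi2 : 2 ≤ i) (hin : i ≤ n1) (hn2 : 2 * n1 < n2) :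
    kappa (Matrix.ProjectiveSpecialLinearGroup (Fin n1) F) r <
      kappa (Matrix.ProjectiveSpecialLinearGroup (Fin n2) F) r := by
  subst hq
  obtain ⟨hi0, hri, hmin⟩ := hi
  have hco : (Fintype.card F - 1).Coprime r := by
    rw [Nat.coprime_comm, hr.coprime_iff_not_dvd]
    intro h
    have := hmin 1 one_pos (by rwa [pow_one])
    omega
  have hrF : (r : F) ≠ 0 := by
    obtain ⟨p, hp⟩ := CharP.exists F
    intro h
    have h1 := (CharP.cast_eq_zero_iff F p r).1 h
    have h2 := (CharP.cast_eq_zero_iff F p _).1 (FiniteField.cast_card_eq_zero F)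
    exact (CharP.char_is_prime F p).ne_one
      (Nat.eq_one_of_dvd_coprimes (hr.coprime_iff_not_dvd.2 hrq) h1 h2)
  have : NeZero n1 := ⟨by omega⟩
  have : NeZero n2 := ⟨by omega⟩
  rw [Matrix.kappa_projectiveSpecialLinearGroup hr hco,
    Matrix.kappa_projectiveSpecialLinearGroup hr hco]
  exact Matrix.SpecialLinearGroup.kappa_lt hr hrF hco hi0 hri hin hn2
end

section
/- Let K be a field, let r be a prime different from the characteristic of K, let d, h be natural numbers with h·r ≤ d, and let σ be a permutation of {1,…,d} whose cycle type consists of exactly h cycles of length r (so σ has d − h·r fixed points). Let V be the fully deleted permutation module for the symmetric group S_d over K, with the induced action of σ. Then for every ω ∈ K with ω^r = 1 and ω ≠ 1, the ω-eigenspace of the action of σ on V has dimension exactly h. -/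
/-- The sum-of-coordinates functional on `K^d`. -/
def sumFunctional (K : Type*) [Field K] (d : ℕ) : (Fin d → K) →ₗ[K] K where
  toFun v := ∑ i, v i
  map_add' u v := by simp [Finset.sum_add_distrib]
  map_smul' c v := by simp [Finset.mul_sum]

/-- The zero-sum submodule `U` of the permutation module `K^d`. -/
def zeroSum (K : Type*) [Field K] (d : ℕ) : Submodule K (Fin d → K) :=
  LinearMap.ker (sumFunctional K d)

/-- The submodule `W` of constant vectors in `K^d`. -/
def constSub (K : Type*) [Field K] (d : ℕ) : Submodule K (Fin d → K) :=
  Submodule.span K {(fun _ => 1 : Fin d → K)}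

/-- `U ∩ W`, viewed as a submodule of `U`. -/
def UW (K : Type*) [Field K] (d : ℕ) : Submodule K (zeroSum K d) :=
  (zeroSum K d ⊓ constSub K d).comap (zeroSum K d).subtype

/-- The fully deleted permutation module `V = U/(U ∩ W)` for `S_d` over `K`. -/
abbrev deletedPermModule (K : Type*) [Field K] (d : ℕ) :=
  zeroSum K d ⧸ UW K d

/-- The linear action of a permutation `σ` on `K^d`, `v ↦ v ∘ σ`. -/
def permMap (K : Type*) [Field K] {d : ℕ} (σ : Equiv.Perm (Fin d)) :
    (Fin d → K) →ₗ[K] (Fin d → K) :=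
  LinearMap.funLeft K K σ

lemma permMap_mem_zeroSum (K : Type*) [Field K] {d : ℕ} (σ : Equiv.Perm (Fin d))
    {v : Fin d → K} (hv : v ∈ zeroSum K d) : permMap K σ v ∈ zeroSum K d := by
  simp only [zeroSum, LinearMap.mem_ker] at hv ⊢
  simpa [permMap, sumFunctional, LinearMap.funLeft, Equiv.sum_comp σ v] using hv

lemma permMap_mem_constSub (K : Type*) [Field K] {d : ℕ} (σ : Equiv.Perm (Fin d))
    {v : Fin d → K} (hv : v ∈ constSub K d) : permMap K σ v ∈ constSub K d := by
  rw [constSub, Submodule.mem_span_singleton] at hv ⊢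
  obtain ⟨c, rfl⟩ := hv
  exact ⟨c, rfl⟩

/-- The endomorphism of the fully deleted permutation module induced by a permutation. -/
def permEnd (K : Type*) [Field K] {d : ℕ} (σ : Equiv.Perm (Fin d)) :
    deletedPermModule K d →ₗ[K] deletedPermModule K d :=
  Submodule.mapQ (UW K d) (UW K d)
    ((permMap K σ).restrict (fun _ hv => permMap_mem_zeroSum K σ hv))
    (by
      rintro ⟨v, hvU⟩ hv
      simp only [UW, Submodule.mem_comap, Submodule.mem_inf, Submodule.coe_subtype,
        LinearMap.restrict_apply] at hv ⊢
      exact ⟨permMap_mem_zeroSum K σ hv.1, permMap_mem_constSub K σ hv.2⟩)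

lemma mem_eigenspace_permMap {K : Type*} [Field K] {d : ℕ} {σ : Equiv.Perm (Fin d)} {ω : K}
    {v : Fin d → K} :
    v ∈ Module.End.eigenspace (permMap K σ) ω ↔ ∀ i, v (σ i) = ω * v i := by
  rw [Module.End.mem_eigenspace_iff, funext_iff]
  rfl

lemma pow_apply_of_mem_eigenspace {K : Type*} [Field K] {d : ℕ} {σ : Equiv.Perm (Fin d)} {ω : K}
    {v : Fin d → K} (hv : v ∈ Module.End.eigenspace (permMap K σ) ω) (n : ℕ) (i : Fin d) :
    v ((σ ^ n) i) = ω ^ n * v i := by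
  induction n with
  | zero => simp
  | succ n ih =>
    rw [pow_succ', Equiv.Perm.mul_apply, mem_eigenspace_permMap.1 hv, ih]
    ring

/-- Averaging a function over the powers of `σ`, weighted by powers of `ω`, gives an
eigenvector. -/
lemma sum_pow_smul_mem_eigenspace {K : Type*} [Field K] {d r : ℕ} {σ : Equiv.Perm (Fin d)} {ω : K}
    (hσ : σ ^ r = 1) (hω : ω ^ r = 1) (g : Fin d → K) :
    (fun i => ∑ k ∈ Finset.range r, ω ^ k * g ((σ ^ k)⁻¹ i)) ∈
      Module.End.eigenspace (permMap K σ) ω := by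
  rw [mem_eigenspace_permMap]
  intro i
  have hshift : ∀ k, ω ^ (k + 1) * g ((σ ^ (k + 1))⁻¹ (σ i)) = ω * (ω ^ k * g ((σ ^ k)⁻¹ i)) := by
    intro k
    rw [pow_succ' σ, mul_inv_rev, Equiv.Perm.mul_apply, Equiv.Perm.inv_def σ, σ.symm_apply_apply]
    ring
  have h₁ := Finset.sum_range_succ (fun k => ω ^ k * g ((σ ^ k)⁻¹ (σ i))) r
  rw [Finset.sum_range_succ'] at h₁
  simp only [hshift, hσ, hω, pow_zero] at h₁
  rw [Finset.mul_sum]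
  exact (add_right_cancel h₁).symm

lemma finrank_eigenspace_permMap {K : Type*} [Field K] {d r : ℕ} (hr : r.Prime)
    {σ : Equiv.Perm (Fin d)} (hσ : σ ^ r = 1) {ω : K} (hω : ω ^ r = 1) (hω1 : ω ≠ 1) :
    Module.finrank K (Module.End.eigenspace (permMap K σ) ω) = σ.cycleType.card := by
  have hrep : ∀ c : σ.cycleFactorsFinset, ∃ i, i ∈ σ.support ∧ σ.cycleOf i = c := by
    rintro ⟨c, hc⟩
    obtain ⟨i, hi⟩ := (Equiv.Perm.mem_cycleFactorsFinset_iff.1 hc).1.nonempty_support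
    exact ⟨i, Equiv.Perm.mem_cycleFactorsFinset_support_le hc hi,
      (Equiv.Perm.cycle_is_cycleOf hi hc).symm⟩
  choose x hx hxc using hrep
  have hxinj : Function.Injective x := fun c c' h => Subtype.ext (by rw [← hxc, ← hxc, h])
  let φ : Module.End.eigenspace (permMap K σ) ω →ₗ[K] (σ.cycleFactorsFinset → K) :=
    LinearMap.funLeft K K x ∘ₗ Submodule.subtype _
  have hφ : ∀ v c, φ v c = v.1 (x c) := fun _ _ => rfl
  have hinj : Function.Injective φ := by
    rw [injective_iff_map_eq_zero]
    intro v hv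
    ext i
    change v.1 i = 0
    by_cases hi : i ∈ σ.support
    · let c : σ.cycleFactorsFinset :=
        ⟨σ.cycleOf i, Equiv.Perm.cycleOf_mem_cycleFactorsFinset_iff.2 hi⟩
      have hsame : σ.SameCycle (x c) i :=
        (Equiv.Perm.sameCycle_iff_cycleOf_eq_of_mem_support (hx c) hi).2 (hxc c)
      obtain ⟨n, -, hn⟩ := hsame.exists_pow_eq'
      rw [← hn, pow_apply_of_mem_eigenspace v.2, ← hφ, hv, Pi.zero_apply, mul_zero]
    · have h := mem_eigenspace_permMap.1 v.2 i
      rw [Equiv.Perm.notMem_support.1 hi] at h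
      have h' : (1 - ω) * v.1 i = 0 := by linear_combination h
      exact (mul_eq_zero.1 h').resolve_left (sub_ne_zero.2 hω1.symm)
  have hsurj : Function.Surjective φ := by
    intro f
    refine ⟨⟨_, sum_pow_smul_mem_eigenspace hσ hω (Function.extend x f 0)⟩, ?_⟩
    ext c
    rw [hφ]
    change ∑ k ∈ Finset.range r, _ = _
    rw [Finset.sum_eq_single_of_mem 0 (Finset.mem_range.2 hr.pos)]
    · simp [hxinj.extend_apply]
    · intro k hk hk0
      rw [Function.extend_apply', Pi.zero_apply, mul_zero]
      rintro ⟨c', hc'⟩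
      have hpow : (σ ^ k) (x c') = x c := by rw [hc', Equiv.Perm.inv_def, Equiv.apply_symm_apply]
      have hcc : c' = c := by
        apply Subtype.ext
        rw [← hxc c', ← hxc c, ← hpow, Equiv.Perm.cycleOf_self_apply_pow]
      subst hcc
      have hper : ∀ n, (σ ^ n) (x c') = x c' → Function.minimalPeriod σ (x c') ∣ n := by
        intro n hn
        apply Function.IsPeriodicPt.minimalPeriod_dvd
        rwa [Function.IsPeriodicPt, Function.IsFixedPt, Equiv.Perm.iterate_eq_pow]
      rcases (Nat.dvd_prime hr).1 (hper r (by rw [hσ]; rfl)) with h1 | h1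
      · exact Equiv.Perm.mem_support.1 (hx c') (Function.minimalPeriod_eq_one_iff_isFixedPt.1 h1)
      · exact Nat.not_dvd_of_pos_of_lt (Nat.pos_of_ne_zero hk0) (Finset.mem_range.1 hk)
          (h1 ▸ hper k hpow)
  rw [(LinearEquiv.ofBijective φ ⟨hinj, hsurj⟩).finrank_eq, Module.finrank_pi,
    Fintype.card_coe, Equiv.Perm.cycleType_def, Multiset.card_map]
  rfl

lemma eigenspace_permMap_le_zeroSum {K : Type*} [Field K] {d : ℕ} (σ : Equiv.Perm (Fin d)) {ω : K}
    (hω1 : ω ≠ 1) : Module.End.eigenspace (permMap K σ) ω ≤ zeroSum K d := by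
  intro v hv
  have h : ∑ i, v i = ω * ∑ i, v i := by
    rw [Finset.mul_sum, ← Equiv.sum_comp σ v]
    exact Finset.sum_congr rfl fun i _ => mem_eigenspace_permMap.1 hv i
  have h' : (1 - ω) * ∑ i, v i = 0 := by linear_combination h
  exact (mul_eq_zero.1 h').resolve_left (sub_ne_zero.2 hω1.symm)

lemma mem_constSub_iff {K : Type*} [Field K] {d : ℕ} {v : Fin d → K} :
    v ∈ constSub K d ↔ ∃ a : K, ∀ i, v i = a := by
  simp [constSub, Submodule.mem_span_singleton, funext_iff, eq_comm]

lemma mem_UW_iff {K : Type*} [Field K] {d : ℕ} {u : zeroSum K d} :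
    u ∈ UW K d ↔ ∃ a : K, ∀ i, u.1 i = a := by
  rw [← mem_constSub_iff]
  exact and_iff_right u.2

/-- For `ω ≠ 1` the quotient map identifies the `ω`-eigenspace of `σ` on `K^d` with the one on the
fully deleted permutation module. -/
lemma finrank_eigenspace_permEnd {K : Type*} [Field K] {d : ℕ} (σ : Equiv.Perm (Fin d)) {ω : K}
    (hω1 : ω ≠ 1) :
    Module.finrank K (Module.End.eigenspace (permEnd K σ) ω) =
      Module.finrank K (Module.End.eigenspace (permMap K σ) ω) := by
  let ψ : Module.End.eigenspace (permMap K σ) ω →ₗ[K] deletedPermModule K d :=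
    (UW K d).mkQ ∘ₗ Submodule.inclusion (eigenspace_permMap_le_zeroSum σ hω1)
  have hinj : Function.Injective ψ := by
    rw [injective_iff_map_eq_zero]
    intro v hv
    obtain ⟨a, ha⟩ := mem_UW_iff.1 ((Submodule.Quotient.mk_eq_zero _).1 hv)
    replace ha : ∀ i, v.1 i = a := ha
    ext i
    have h := mem_eigenspace_permMap.1 v.2 i
    rw [ha (σ i), ← ha i] at h
    have h' : (1 - ω) * v.1 i = 0 := by linear_combination h
    exact (mul_eq_zero.1 h').resolve_left (sub_ne_zero.2 hω1.symm)
  have hrange : LinearMap.range ψ = Module.End.eigenspace (permEnd K σ) ω := by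
    apply le_antisymm
    · rintro _ ⟨v, rfl⟩
      rw [Module.End.mem_eigenspace_iff]
      refine congrArg (UW K d).mkQ (Subtype.ext ?_)
      exact Module.End.mem_eigenspace_iff.1 v.2
    · intro q hq
      obtain ⟨u, rfl⟩ := (UW K d).mkQ_surjective q
      rw [Module.End.mem_eigenspace_iff] at hq
      obtain ⟨c, hc⟩ := mem_UW_iff.1 ((Submodule.Quotient.eq (UW K d)).1 hq)
      replace hc : ∀ i, u.1 (σ i) - ω * u.1 i = c := hc
      have hne : 1 - ω ≠ 0 := sub_ne_zero.2 hω1.symm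
      have hmem : (fun i => u.1 i - c / (1 - ω)) ∈ Module.End.eigenspace (permMap K σ) ω := by
        rw [mem_eigenspace_permMap]
        intro i
        have := hc i
        field_simp
        linear_combination (1 - ω) * this
      refine ⟨⟨_, hmem⟩, (Submodule.Quotient.eq (UW K d)).2 (mem_UW_iff.2 ⟨-(c / (1 - ω)), ?_⟩)⟩
      intro i
      change u.1 i - c / (1 - ω) - u.1 i = _
      ring
  rw [← hrange, LinearMap.finrank_range_of_inj hinj]

/-- Lemma 3.3: if `σ ∈ S_d` has cycle type consisting of `h` cycles of length `r`
(`r` a prime different from the characteristic of `K`), then every nontrivial `r`-th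
root of unity `ω ∈ K` occurs as an eigenvalue of `σ` on the fully deleted permutation
module with multiplicity exactly `h`. -/
theorem stmt_11 (K : Type*) [Field K] (r : ℕ) (hr : r.Prime) (hchar : ringChar K ≠ r)
    (d h : ℕ) (hhr : h * r ≤ d)
    (σ : Equiv.Perm (Fin d)) (hσ : σ.cycleType = Multiset.replicate h r)
    (ω : K) (hω : ω ^ r = 1) (hω1 : ω ≠ 1) :
    Module.finrank K (Module.End.eigenspace (permEnd K σ) ω) = h := by
  have hpow : σ ^ r = 1 := by
    rw [← orderOf_dvd_iff_pow_eq_one, ← Equiv.Perm.lcm_cycleType, Multiset.lcm_dvd, hσ]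
    intro b hb
    rw [Multiset.eq_of_mem_replicate hb]
  rw [finrank_eigenspace_permEnd σ hω1, finrank_eigenspace_permMap hr hpow hω hω1, hσ,
    Multiset.card_replicate]
end
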